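/- arXiv:2203.03032 — 14 statements merged into one kernel-verified Lean document; each statement's English description precedes it below -/
import Mathlib

section
/- Let ℱ be a convex set of Borel probability measures on ℝ and let a : ℝ × ℱ → ℝ be such that y ↦ a(y, F') is Borel measurable and integrable with respect to every member of ℱ for each F' ∈ ℱ, and ∫ a(y, F') dF'(y) = 0 for every F' ∈ ℱ. Fix F, G ∈ ℱ and for t ∈ [0,1] set F_t = (1−t)F + tG. If t ↦ ∫ a(y, F_t) dG(y) is right-continuous at t = 0, then t ↦ ∫ a(y, F_t) dF(y) has a right derivative at t = 0 equal to −∫ a(y, F) dG(y). -/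
open MeasureTheory Set Filter

/-- Mean-zero influence functions satisfy the Neyman orthogonality identity:
if `∫ a(y, F') dF'(y) = 0` for every `F'` in the convex family `𝓕` and
`t ↦ ∫ a(y, F_t) dG(y)` is right-continuous at `t = 0` (where `F_t = (1-t)F + tG`),
then `t ↦ ∫ a(y, F_t) dF(y)` has right derivative `-∫ a(y, F) dG(y)` at `t = 0`. -/
theorem stmt1
    (𝓕 : Set (Measure ℝ))
    (hprob : ∀ μ ∈ 𝓕, IsProbabilityMeasure μ)
    (hconv : ∀ μ ∈ 𝓕, ∀ ν ∈ 𝓕, ∀ t ∈ Icc (0:ℝ) 1,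
      ENNReal.ofReal (1 - t) • μ + ENNReal.ofReal t • ν ∈ 𝓕)
    (a : ℝ → Measure ℝ → ℝ)
    (hmeas : ∀ F' ∈ 𝓕, Measurable fun y => a y F')
    (hint : ∀ F' ∈ 𝓕, ∀ μ ∈ 𝓕, Integrable (fun y => a y F') μ)
    (hzero : ∀ F' ∈ 𝓕, ∫ y, a y F' ∂F' = 0)
    (F G : Measure ℝ) (hF : F ∈ 𝓕) (hG : G ∈ 𝓕)
    (hcont : ContinuousWithinAt
      (fun t : ℝ => ∫ y, a y (ENNReal.ofReal (1 - t) • F + ENNReal.ofReal t • G) ∂G)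
      (Ici (0:ℝ)) 0) :
    HasDerivWithinAt
      (fun t : ℝ => ∫ y, a y (ENNReal.ofReal (1 - t) • F + ENNReal.ofReal t • G) ∂F)
      (-∫ y, a y F ∂G) (Ici (0:ℝ)) 0 := by
  have h0 : ENNReal.ofReal (1 - 0) • F + ENNReal.ofReal 0 • G = F := by simp
  have key : ∀ t ∈ Icc (0:ℝ) 1,
      (1 - t) * (∫ y, a y (ENNReal.ofReal (1 - t) • F + ENNReal.ofReal t • G) ∂F)
        + t * (∫ y, a y (ENNReal.ofReal (1 - t) • F + ENNReal.ofReal t • G) ∂G) = 0 := by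
    intro t ht
    have hm := hconv F hF G hG t ht
    have hz := hzero _ hm
    have iF := hint _ hm F hF
    have iG := hint _ hm G hG
    rw [integral_add_measure (iF.smul_measure ENNReal.ofReal_ne_top)
      (iG.smul_measure ENNReal.ofReal_ne_top), integral_smul_measure, integral_smul_measure,
      ENNReal.toReal_ofReal (by linarith [ht.2]), ENNReal.toReal_ofReal ht.1] at hz
    simpa [smul_eq_mul] using hz
  have hz0 : ∫ y, a y F ∂F = 0 := hzero F hF
  rw [hasDerivWithinAt_iff_tendsto_slope]
  have hc : Tendsto (fun t : ℝ =>
      -(∫ y, a y (ENNReal.ofReal (1 - t) • F + ENNReal.ofReal t • G) ∂G) / (1 - t))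
      (nhdsWithin 0 (Ici (0:ℝ) \ {0})) (nhds (-∫ y, a y F ∂G)) := by
    have h1 := hcont.tendsto
    simp only [h0] at h1
    have h2 : Tendsto (fun t : ℝ => 1 - t) (nhdsWithin 0 (Ici (0:ℝ))) (nhds 1) := by
      have : Continuous (fun t : ℝ => 1 - t) := by fun_prop
      simpa using (this.tendsto 0).mono_left (nhdsWithin_le_nhds (s := Ici (0:ℝ)))
    have h3 := h1.neg.div h2 one_ne_zero
    rw [div_one] at h3
    exact h3.mono_left (nhdsWithin_mono _ sdiff_subset)
  refine hc.congr' ?_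
  have hlt : ∀ᶠ t : ℝ in nhdsWithin 0 (Ici (0:ℝ) \ {0}), t < 1 :=
    nhdsWithin_le_nhds (Iio_mem_nhds one_pos)
  filter_upwards [hlt, self_mem_nhdsWithin] with t ht1 ht
  have htn : t ≠ 0 := ht.2
  have hk := key t ⟨ht.1, ht1.le⟩
  have h1t : 1 - t ≠ 0 := by linarith
  rw [slope_def_field]
  simp only [h0, hz0]
  rw [sub_zero, sub_zero]
  rw [div_eq_div_iff h1t htn]
  linarith
end

section
/- Let F : ℝ → ℝ be a cumulative distribution function that is continuously differentiable on ℝ with everywhere positive derivative f, and let G : ℝ → ℝ be a continuous cumulative distribution function. Fix u ∈ (0,1). Then for every t ∈ [0,1) there is a unique real number q_t with (1−t)F(q_t) + tG(q_t) = u, and the map t ↦ q_t has a right derivative at t = 0 equal to (u − G(q_0)) / f(q_0), where q_0 satisfies F(q_0) = u. -/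
open MeasureTheory Set Filter

/-- Influence function of the `u`-th quantile: if `F` is a continuously differentiable
CDF with everywhere positive density `f` and `G` is a continuous CDF, then for every
`t ∈ [0,1)` the mixture `(1-t)F + tG` has a unique `u`-th quantile `q t`, and
`t ↦ q t` has right derivative `(u - G (q 0)) / f (q 0)` at `t = 0`, where `F (q 0) = u`. -/
theorem stmt2
    (F G f : ℝ → ℝ)
    (hF' : ∀ x, HasDerivAt F (f x) x) (hf_cont : Continuous f) (hf_pos : ∀ x, 0 < f x)
    (hF0 : Tendsto F atBot (nhds 0)) (hF1 : Tendsto F atTop (nhds 1))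
    (hG_mono : Monotone G) (hG_cont : Continuous G)
    (hG0 : Tendsto G atBot (nhds 0)) (hG1 : Tendsto G atTop (nhds 1))
    (u : ℝ) (hu : u ∈ Ioo (0:ℝ) 1) :
    ∃ q : ℝ → ℝ,
      (∀ t ∈ Ico (0:ℝ) 1,
        (1 - t) * F (q t) + t * G (q t) = u ∧
        ∀ x : ℝ, (1 - t) * F x + t * G x = u → x = q t) ∧
      F (q 0) = u ∧
      HasDerivWithinAt q ((u - G (q 0)) / f (q 0)) (Ici (0:ℝ)) 0 := by
  obtain ⟨hu0, hu1⟩ := hu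
  have hFc : Continuous F := continuous_iff_continuousAt.2 fun x => (hF' x).continuousAt
  have hFm : StrictMono F := strictMono_of_deriv_pos fun x => by
    rw [(hF' x).deriv]; exact hf_pos x
  have hHm : ∀ t ∈ Ico (0:ℝ) 1, StrictMono fun x => (1 - t) * F x + t * G x := by
    rintro t ⟨h0, h1⟩ x y hxy
    have a := mul_lt_mul_of_pos_left (hFm hxy) (sub_pos.2 h1)
    have b := mul_le_mul_of_nonneg_left (hG_mono hxy.le) h0
    exact add_lt_add_of_lt_of_le a b
  have hex : ∀ t ∈ Ico (0:ℝ) 1, ∃ x, (1 - t) * F x + t * G x = u := by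
    intro t ht
    have hc : Continuous fun x => (1 - t) * F x + t * G x := by fun_prop
    have l0 : Tendsto (fun x => (1 - t) * F x + t * G x) atBot (nhds 0) := by
      have := (hF0.const_mul (1 - t)).add (hG0.const_mul t)
      simpa using this
    have l1 : Tendsto (fun x => (1 - t) * F x + t * G x) atTop (nhds 1) := by
      have := (hF1.const_mul (1 - t)).add (hG1.const_mul t)
      simpa using this
    obtain ⟨a, ha⟩ := (l0.eventually_lt_const hu0).exists
    obtain ⟨b, hb⟩ := (l1.eventually_const_lt hu1).exists
    exact mem_range_of_exists_le_of_exists_ge hc ⟨a, ha.le⟩ ⟨b, hb.le⟩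
  choose! q hq using hex
  have hq0 : F (q 0) = u := by
    have := hq 0 (by simp)
    simpa using this
  refine ⟨q, fun t ht => ⟨hq t ht, fun x hx => (hHm t ht).injective (hx.trans (hq t ht).symm)⟩,
    hq0, ?_⟩
  have hlt : ∀ᶠ t in nhdsWithin (0:ℝ) (Ioi 0), t ∈ Ioo (0:ℝ) 1 :=
    Ioo_mem_nhdsGT one_pos
  have hlim : ∀ x, Tendsto (fun t : ℝ => (1 - t) * F x + t * G x)
      (nhdsWithin (0:ℝ) (Ioi 0)) (nhds (F x)) := by
    intro x
    have hc : Continuous fun t : ℝ => (1 - t) * F x + t * G x := by fun_prop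
    have := (hc.tendsto 0).mono_left (nhdsWithin_le_nhds (s := Ioi 0))
    simpa using this
  have hqc : Tendsto q (nhdsWithin (0:ℝ) (Ioi 0)) (nhds (q 0)) := by
    rw [tendsto_order]
    constructor
    · intro a ha
      have h1 : F a < u := hq0 ▸ hFm ha
      filter_upwards [hlt, (hlim a).eventually_lt_const h1] with t ht h
      rw [← hq t ⟨ht.1.le, ht.2⟩] at h
      exact (hHm t ⟨ht.1.le, ht.2⟩).lt_iff_lt.1 h
    · intro a ha
      have h1 : u < F a := hq0 ▸ hFm ha
      filter_upwards [hlt, (hlim a).eventually_const_lt h1] with t ht h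
      rw [← hq t ⟨ht.1.le, ht.2⟩] at h
      exact (hHm t ⟨ht.1.le, ht.2⟩).lt_iff_lt.1 h
  have hd : ContinuousAt (dslope F (q 0)) (q 0) :=
    continuousAt_dslope_same.2 (hF' _).differentiableAt
  have hd0 : dslope F (q 0) (q 0) = f (q 0) := by rw [dslope_same, (hF' _).deriv]
  have hdl : Tendsto (fun t => dslope F (q 0) (q t)) (nhdsWithin (0:ℝ) (Ioi 0))
      (nhds (f (q 0))) := by
    rw [← hd0]; exact hd.tendsto.comp hqc
  rw [← hasDerivWithinAt_Ioi_iff_Ici, hasDerivWithinAt_iff_tendsto_slope' (by simp)]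
  have hn : Tendsto (fun t => F (q t) - G (q t)) (nhdsWithin (0:ℝ) (Ioi 0))
      (nhds (u - G (q 0))) := by
    rw [← hq0]
    exact ((hFc.tendsto _).comp hqc).sub ((hG_cont.tendsto _).comp hqc)
  refine (hn.div hdl (hf_pos _).ne').congr' ?_
  filter_upwards [hlt, hdl.eventually_const_lt (hf_pos _)] with t ht hp
  have e1 := sub_smul_dslope F (q 0) (q t)
  have e2 := hq t ⟨ht.1.le, ht.2⟩
  have ht0 : t ≠ 0 := ht.1.ne'
  rw [smul_eq_mul, hq0] at e1
  rw [Pi.div_apply, slope_def_field, sub_zero, div_eq_div_iff hp.ne' ht0, e1]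
  linarith
end

section
/- Let μ be a Borel probability measure on ℝ with ∫ |y| dμ(y) < ∞, let F be its cumulative distribution function, and for u ∈ (0,1) let q(u) = inf{ s ∈ ℝ : F(s) ≥ u } be the quantile function. Let ψ : [0,1] → ℝ be bounded and Borel measurable, and set Ψ(t) = ∫_0^t ψ(u) du and Ψ̄ = Ψ(1). Then all integrals below converge absolutely and ∫_0^1 q(u) ψ(u) du = −∫_{−∞}^0 Ψ(F(s)) ds + ∫_0^{+∞} ( Ψ̄ − Ψ(F(s)) ) ds. -/
open MeasureTheory Set Filter

lemma gen_aux (ν σ : Measure ℝ) [SFinite ν] [SFinite σ] (A : Set (ℝ × ℝ)) (hA : MeasurableSet A)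
    (ψ p : ℝ → ℝ) (hψ : Measurable ψ) (hp0 : ∀ u, 0 ≤ p u)
    (hi : Integrable (fun u => p u * ψ u) ν)
    (hp : ∀ᵐ u ∂ν, σ {s | (u, s) ∈ A} = ENNReal.ofReal (p u)) :
    Integrable (fun s => ∫ u in {u | (u, s) ∈ A}, ψ u ∂ν) σ ∧
    ∫ u, p u * ψ u ∂ν = ∫ s, ∫ u in {u | (u, s) ∈ A}, ψ u ∂ν ∂σ := by
  have hsec1 : ∀ u, MeasurableSet {s | (u, s) ∈ A} := fun u => measurable_prodMk_left hA
  have hsec2 : ∀ s, MeasurableSet {u | (u, s) ∈ A} := fun s => measurable_prodMk_right hA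
  set g : ℝ × ℝ → ℝ := A.indicator (fun z => ψ z.1) with hg
  have hgm : Measurable g := (hψ.comp measurable_fst).indicator hA
  have h1 : ∀ u, (fun s => g (u, s)) = {s | (u, s) ∈ A}.indicator (fun _ => ψ u) := by
    intro u; ext s; simp [hg, indicator]
  have h2 : ∀ s, (fun u => g (u, s)) = {u | (u, s) ∈ A}.indicator ψ := by
    intro s; ext u; simp [hg, indicator]
  have h3 : ∀ᵐ u ∂ν, ∫ s, g (u, s) ∂σ = p u * ψ u := by
    filter_upwards [hp] with u hu
    rw [h1, integral_indicator_const _ (hsec1 u), Measure.real, hu,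
      ENNReal.toReal_ofReal (hp0 u), smul_eq_mul]
  have h4 : ∀ᵐ u ∂ν, ∫ s, ‖g (u, s)‖ ∂σ = ‖p u * ψ u‖ := by
    filter_upwards [hp] with u hu
    have : (fun s => ‖g (u, s)‖) = {s | (u, s) ∈ A}.indicator (fun _ => ‖ψ u‖) := by
      ext s
      rw [show g (u, s) = (fun s => g (u, s)) s from rfl, h1, norm_indicator_eq_indicator_norm]
    rw [this, integral_indicator_const _ (hsec1 u), Measure.real, hu,
      ENNReal.toReal_ofReal (hp0 u), smul_eq_mul, norm_mul, Real.norm_of_nonneg (hp0 u)]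
  have hint : Integrable g (ν.prod σ) := by
    rw [integrable_prod_iff hgm.aestronglyMeasurable]
    constructor
    · filter_upwards [hp] with u hu
      rw [h1, integrable_indicator_iff (hsec1 u)]
      exact integrableOn_const (by rw [hu]; exact ENNReal.ofReal_ne_top)
    · exact hi.norm.congr (h4.mono fun u hu => hu.symm)
  have h5 : ∀ s, ∫ u, g (u, s) ∂ν = ∫ u in {u | (u, s) ∈ A}, ψ u ∂ν := by
    intro s; rw [h2, integral_indicator (hsec2 s)]
  constructor
  · exact hint.integral_prod_right.congr (Eventually.of_forall h5)
  · rw [← integral_congr_ae h3, ← integral_prod g hint, integral_prod_symm g hint]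
    simp_rw [h5]

theorem stmt3
    (μ : Measure ℝ) [IsProbabilityMeasure μ]
    (hμ : Integrable (fun y => y) μ)
    (F : ℝ → ℝ) (hF : ∀ s, F s = (μ (Iic s)).toReal)
    (q : ℝ → ℝ) (hq : ∀ u, q u = sInf {s : ℝ | u ≤ F s})
    (ψ : ℝ → ℝ) (hψm : Measurable ψ)
    (M : ℝ) (hψb : ∀ u ∈ Icc (0:ℝ) 1, |ψ u| ≤ M)
    (Ψ : ℝ → ℝ) (hΨ : ∀ t, Ψ t = ∫ u in (0:ℝ)..t, ψ u) :
    IntegrableOn (fun u => q u * ψ u) (Ioo 0 1) volume ∧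
    IntegrableOn (fun s => Ψ (F s)) (Iic 0) volume ∧
    IntegrableOn (fun s => Ψ 1 - Ψ (F s)) (Ioi 0) volume ∧
    ∫ u in Ioo (0:ℝ) 1, q u * ψ u =
      (-(∫ s in Iic (0:ℝ), Ψ (F s))) + ∫ s in Ioi (0:ℝ), (Ψ 1 - Ψ (F s)) := by
  have hFc : F = ProbabilityTheory.cdf μ := by
    ext s; rw [hF, ProbabilityTheory.cdf_eq_real]; rfl
  have hmono : Monotone F := hFc ▸ ProbabilityTheory.monotone_cdf μ
  have hF0 : ∀ s, 0 ≤ F s := fun s => hFc ▸ ProbabilityTheory.cdf_nonneg μ s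
  have hF1 : ∀ s, F s ≤ 1 := fun s => hFc ▸ ProbabilityTheory.cdf_le_one μ s
  have hbot : Tendsto F atBot (nhds 0) := hFc ▸ ProbabilityTheory.tendsto_cdf_atBot μ
  have htop : Tendsto F atTop (nhds 1) := hFc ▸ ProbabilityTheory.tendsto_cdf_atTop μ
  have hrc : ∀ s, Tendsto F (nhdsWithin s (Ioi s)) (nhds (F s)) := by
    intro s
    have := (ProbabilityTheory.cdf μ).right_continuous s
    rw [← hFc] at this
    exact this.tendsto.mono_left (nhdsWithin_mono _ Ioi_subset_Ici_self)
  have hbdd : ∀ u ∈ Ioo (0:ℝ) 1, BddBelow {s : ℝ | u ≤ F s} := by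
    intro u hu
    obtain ⟨a, ha⟩ := (hbot.eventually (gt_mem_nhds hu.1)).exists
    refine ⟨a, fun s hs => ?_⟩
    by_contra! h
    exact absurd (hmono h.le) (not_le.2 (lt_of_lt_of_le ha hs))
  have hne : ∀ u ∈ Ioo (0:ℝ) 1, {s : ℝ | u ≤ F s}.Nonempty := by
    intro u hu
    obtain ⟨a, ha⟩ := (htop.eventually (lt_mem_nhds hu.2)).exists
    exact ⟨a, ha.le⟩
  have gal : ∀ u ∈ Ioo (0:ℝ) 1, ∀ s, q u ≤ s ↔ u ≤ F s := by
    intro u hu s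
    rw [hq]
    constructor
    · intro h
      refine ge_of_tendsto (hrc s) ?_
      filter_upwards [self_mem_nhdsWithin] with t ht
      obtain ⟨r, hr, hrt⟩ := exists_lt_of_csInf_lt (hne u hu) (lt_of_le_of_lt h ht)
      exact le_trans hr (hmono hrt.le)
    · intro h
      exact csInf_le (hbdd u hu) h
  have qmono : MonotoneOn q (Ioo 0 1) := by
    intro u hu v hv huv
    rw [gal u hu]
    exact huv.trans ((gal v hv _).1 le_rfl)
  set ν : Measure ℝ := volume.restrict (Ioo (0:ℝ) 1) with hν
  have hae : ∀ᵐ u ∂ν, u ∈ Ioo (0:ℝ) 1 := ae_restrict_mem measurableSet_Ioo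
  have hqm : AEMeasurable q ν := aemeasurable_restrict_of_monotoneOn measurableSet_Ioo qmono
  have hmap : ν.map q = μ := by
    have : IsFiniteMeasure (ν.map q) := by
      infer_instance
    refine Measure.ext_of_Iic _ _ fun s => ?_
    rw [Measure.map_apply_of_aemeasurable hqm measurableSet_Iic]
    have e1 : ν (q ⁻¹' Iic s) = ν (Iic (F s)) := by
      refine measure_congr ?_
      filter_upwards [hae] with u hu
      exact propext (gal u hu s)
    rw [e1, hν, restrict_Ioo_eq_restrict_Ioc, Measure.restrict_apply measurableSet_Iic]
    have e2 : Iic (F s) ∩ Ioc 0 1 = Ioc 0 (F s) := by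
      ext x; simp only [mem_inter_iff, mem_Iic, mem_Ioc]
      exact ⟨fun h => ⟨h.2.1, h.1⟩, fun h => ⟨h.2, h.1, h.2.trans (hF1 s)⟩⟩
    rw [e2, Real.volume_Ioc, sub_zero, hF, ENNReal.ofReal_toReal (measure_ne_top _ _)]
  have hqi : Integrable q ν := by
    rw [← hmap] at hμ
    exact (integrable_map_measure aestronglyMeasurable_id hqm).1 hμ
  have hbd : ∀ᵐ u ∂ν, ‖ψ u‖ ≤ M := hae.mono fun u hu => hψb u ⟨hu.1.le, hu.2.le⟩
  have hI : ∀ f : ℝ → ℝ, Integrable f ν → Integrable (fun u => f u * ψ u) ν := fun f hf =>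
    hf.mul_bdd hψm.aestronglyMeasurable hbd
  have hψi : IntegrableOn ψ (Ioc 0 1) volume := by
    have := hI (fun _ => 1) (integrable_const _)
    simp only [one_mul] at this
    rwa [hν, restrict_Ioo_eq_restrict_Ioc] at this
  have hΨ' : ∀ t ∈ Icc (0:ℝ) 1, ∫ u in Iic t, ψ u ∂ν = Ψ t := by
    intro t ht
    rw [hΨ, intervalIntegral.integral_of_le ht.1, hν, restrict_Ioo_eq_restrict_Ioc,
      Measure.restrict_restrict measurableSet_Iic]
    congr 2
    ext x; simp only [mem_inter_iff, mem_Iic, mem_Ioc]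
    exact ⟨fun h => ⟨h.2.1, h.1⟩, fun h => ⟨h.2, h.1, h.2.trans ht.2⟩⟩
  have hΨ'' : ∀ t ∈ Icc (0:ℝ) 1, ∫ u in Ioi t, ψ u ∂ν = Ψ 1 - Ψ t := by
    intro t ht
    have hii : Integrable ψ ν := by rw [hν, restrict_Ioo_eq_restrict_Ioc]; exact hψi
    have := integral_add_compl (measurableSet_Iic (a := t)) hii
    rw [hΨ' t ht, compl_Iic] at this
    have h1 : ∫ u, ψ u ∂ν = Ψ 1 := by
      rw [hΨ, intervalIntegral.integral_of_le zero_le_one, hν, restrict_Ioo_eq_restrict_Ioc]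
    linarith
  have hFm : Measurable F := hmono.measurable
  obtain ⟨a1, a2⟩ := gen_aux ν (volume.restrict (Ioi 0)) {z | F z.2 < z.1}
    (measurableSet_lt (hFm.comp measurable_snd) measurable_fst) ψ (fun u => max (q u) 0) hψm
    (fun u => le_max_right _ _) (hI _ hqi.pos_part) (by
      filter_upwards [hae] with u hu
      have : {s | F s < u} = Iio (q u) := by
        ext s; simp only [mem_ofPred_eq, mem_Iio]
        rw [← not_le, ← not_le, gal u hu]
      rw [this, Measure.restrict_apply measurableSet_Iio, Iio_inter_Ioi, Real.volume_Ioo, sub_zero]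
      simp [ENNReal.ofReal, Real.toNNReal])
  obtain ⟨b1, b2⟩ := gen_aux ν (volume.restrict (Iic 0)) {z | z.1 ≤ F z.2}
    (measurableSet_le measurable_fst (hFm.comp measurable_snd)) ψ (fun u => max (-q u) 0) hψm
    (fun u => le_max_right _ _) (hI _ hqi.neg_part) (by
      filter_upwards [hae] with u hu
      have : {s | u ≤ F s} = Ici (q u) := by
        ext s; simp only [mem_ofPred_eq, mem_Ici]
        rw [gal u hu]
      rw [this, Measure.restrict_apply measurableSet_Ici, Ici_inter_Iic, Real.volume_Icc, zero_sub]
      simp [ENNReal.ofReal, Real.toNNReal])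
  have ea : ∀ s, ∫ u in {u | (u, s) ∈ {z : ℝ × ℝ | F z.2 < z.1}}, ψ u ∂ν = Ψ 1 - Ψ (F s) :=
    fun s => hΨ'' (F s) ⟨hF0 s, hF1 s⟩
  have eb : ∀ s, ∫ u in {u | (u, s) ∈ {z : ℝ × ℝ | z.1 ≤ F z.2}}, ψ u ∂ν = Ψ (F s) :=
    fun s => hΨ' (F s) ⟨hF0 s, hF1 s⟩
  simp only [ea] at a1 a2
  simp only [eb] at b1 b2
  refine ⟨hI q hqi, b1, a1, ?_⟩
  rw [← a2, ← b2, neg_add_eq_sub, ← integral_sub (hI _ hqi.pos_part) (hI _ hqi.neg_part)]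
  congr 1
  ext u
  rw [← sub_mul]
  congr 1
  rcases le_total (q u) 0 with h | h
  · rw [max_eq_right h, max_eq_left (by linarith)]; ring
  · rw [max_eq_left h, max_eq_right (by linarith)]; ring
end

section
/- Let F : ℝ → (0,1) be a continuously differentiable cumulative distribution function with everywhere positive derivative f, with lim_{s→−∞} F(s) = 0 and lim_{s→+∞} F(s) = 1, whose associated probability measure has a finite first moment, and let q = F^{-1} : (0,1) → ℝ be its inverse. Let ψ : [0,1] → ℝ be bounded and Borel measurable. Then for every y ∈ ℝ both integrals below converge absolutely and ∫_0^1 [ (u − 1{y ≤ q(u)}) / f(q(u)) ] ψ(u) du = ∫_ℝ ( F(s) − 1{y ≤ s} ) ψ(F(s)) ds. -/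
open MeasureTheory Set Filter

lemma stmt4_tail (F f : ℝ → ℝ)
    (hF' : ∀ x, HasDerivAt F (f x) x) (hf_cont : Continuous f) (hf_pos : ∀ x, 0 < f x)
    (hrange : ∀ x, F x ∈ Ioo (0:ℝ) 1) (hF1 : Tendsto F atTop (nhds 1))
    (hmoment : Integrable (fun s => |s| * f s) volume) (y : ℝ) :
    IntegrableOn (fun s => 1 - F s) (Ici y) volume := by
  have hFc : Continuous F := continuous_iff_continuousAt.2 fun x => (hF' x).continuousAt
  have h0 : IntegrableOn (fun s => 1 - F s) (Ioi 0) volume := by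
    refine ⟨(by fun_prop : Continuous fun s => 1 - F s).aestronglyMeasurable, ?_⟩
    rw [hasFiniteIntegral_iff_ofReal (Eventually.of_forall fun s => by
      have := (hrange s).2; simp; linarith)]
    let μ := (volume : Measure ℝ).withDensity (fun s => ENNReal.ofReal (f s))
    have hm : Measurable (fun s => ENNReal.ofReal (f s)) := by fun_prop
    have key := lintegral_eq_lintegral_meas_lt μ (f := fun s : ℝ => |s|)
      (Eventually.of_forall fun s => abs_nonneg s) (by fun_prop)
    have hfin : ∫⁻ s, ENNReal.ofReal |s| ∂μ < ⊤ := by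
      have h2 := hmoment.2
      rw [hasFiniteIntegral_iff_ofReal (Eventually.of_forall fun s =>
        mul_nonneg (abs_nonneg s) (hf_pos s).le)] at h2
      rw [lintegral_withDensity_eq_lintegral_mul _ hm (by fun_prop)]
      refine lt_of_le_of_lt (lintegral_mono fun s => le_of_eq ?_) h2
      rw [Pi.mul_apply, mul_comm, ENNReal.ofReal_mul (abs_nonneg s)]
    rw [key] at hfin
    refine lt_of_le_of_lt (lintegral_mono fun t => ?_) hfin
    have hsub : Ioi t ⊆ {a : ℝ | t < |a|} := fun a ha => lt_of_lt_of_le ha (le_abs_self a)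
    refine le_trans (le_of_eq ?_) (measure_mono hsub)
    have hint : IntegrableOn f (Ioi t) :=
      integrableOn_Ioi_deriv_of_nonneg' (fun x _ => hF' x) (fun x _ => (hf_pos x).le) hF1
    rw [withDensity_apply _ measurableSet_Ioi,
      ← ofReal_integral_eq_lintegral_ofReal hint (Eventually.of_forall fun s => (hf_pos s).le),
      integral_Ioi_of_hasDerivAt_of_tendsto' (fun x _ => hF' x) hint hF1]
  have h1 : IntegrableOn (fun s => 1 - F s) (Icc y 0) volume :=
    (by fun_prop : Continuous fun s => 1 - F s).continuousOn.integrableOn_Icc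
  refine (h1.union h0).mono_set fun s hs => ?_
  rcases le_or_gt s 0 with h | h
  · exact Or.inl ⟨hs, h⟩
  · exact Or.inr h

/-- Change-of-variables identity for the influence-function adjustment of the
weighted-average quantile functional: for a smooth CDF `F` with positive density `f`,
inverse (quantile) function `q`, and a bounded measurable weight `ψ`, for every `y`,
`∫_0^1 (u - 1{y ≤ q(u)}) / f(q(u)) ψ(u) du = ∫_ℝ (F(s) - 1{y ≤ s}) ψ(F(s)) ds`,
and both integrals converge absolutely. -/
theorem stmt4
    (F f q : ℝ → ℝ)
    (hF' : ∀ x, HasDerivAt F (f x) x) (hf_cont : Continuous f) (hf_pos : ∀ x, 0 < f x)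
    (hrange : ∀ x, F x ∈ Ioo (0:ℝ) 1)
    (hF0 : Tendsto F atBot (nhds 0)) (hF1 : Tendsto F atTop (nhds 1))
    (hmoment : Integrable (fun s => |s| * f s) volume)
    (hq : ∀ u ∈ Ioo (0:ℝ) 1, F (q u) = u) (hq' : ∀ s, q (F s) = s)
    (ψ : ℝ → ℝ) (hψm : Measurable ψ)
    (M : ℝ) (hψb : ∀ u ∈ Icc (0:ℝ) 1, |ψ u| ≤ M)
    (y : ℝ) :
    IntegrableOn
      (fun u => (u - if y ≤ q u then (1:ℝ) else 0) / f (q u) * ψ u) (Ioo 0 1) volume ∧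
    Integrable (fun s => (F s - if y ≤ s then (1:ℝ) else 0) * ψ (F s)) volume ∧
    ∫ u in Ioo (0:ℝ) 1, (u - if y ≤ q u then (1:ℝ) else 0) / f (q u) * ψ u =
      ∫ s, (F s - if y ≤ s then (1:ℝ) else 0) * ψ (F s) := by
  have hFc : Continuous F := continuous_iff_continuousAt.2 fun x => (hF' x).continuousAt
  have hinj : InjOn F univ := fun a _ b _ h => by rw [← hq' a, h, hq' b]
  have himg : F '' univ = Ioo 0 1 := by
    ext u
    constructor
    · rintro ⟨x, _, rfl⟩
      exact hrange x
    · exact fun hu => ⟨q u, trivial, hq u hu⟩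
  have hup := stmt4_tail F f hF' hf_cont hf_pos hrange hF1 hmoment y
  have hlow : IntegrableOn F (Iio y) := by
    have h := stmt4_tail (fun s => 1 - F (-s)) (fun s => f (-s))
      (fun x => by
        have := ((hF' (-x)).comp x (hasDerivAt_neg x)).const_sub 1
        exact this.congr_deriv (by ring))
      (by fun_prop) (fun x => hf_pos _)
      (fun x => ⟨by have := (hrange (-x)).2; linarith, by have := (hrange (-x)).1; linarith⟩)
      (by simpa using (hF0.comp tendsto_neg_atTop_atBot).const_sub 1)
      (by simpa using hmoment.comp_neg) (-y)
    simp only [sub_sub_cancel] at h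
    have h' : IntegrableOn F (Iic y) := by
      have := h.comp_neg
      simpa using this
    exact h'.mono_set Iio_subset_Iic_self
  have hH : Integrable (fun s => F s - if y ≤ s then (1:ℝ) else 0) volume := by
    rw [← integrableOn_univ, ← Iio_union_Ici (a := y)]
    refine IntegrableOn.union ?_ ?_
    · refine hlow.congr_fun (fun s hs => ?_) measurableSet_Iio
      simp [not_le.2 (show s < y from hs)]
    · refine hup.neg.congr_fun (fun s hs => ?_) measurableSet_Ici
      simp [show y ≤ s from hs]
  have hI : Integrable (fun s => (F s - if y ≤ s then (1:ℝ) else 0) * ψ (F s)) volume :=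
    hH.mul_bdd (c := M) (hψm.comp hFc.measurable).aestronglyMeasurable
      (Eventually.of_forall fun s => hψb _ (Ioo_subset_Icc_self (hrange s)))
  have heq : (fun s => |f s| • ((F s - if y ≤ q (F s) then (1:ℝ) else 0) / f (q (F s)) * ψ (F s)))
      = fun s => (F s - if y ≤ s then (1:ℝ) else 0) * ψ (F s) := by
    funext s
    have := (hf_pos s).ne'
    rw [hq', abs_of_pos (hf_pos s), smul_eq_mul]
    field_simp
  refine ⟨?_, hI, ?_⟩
  · rw [← himg, integrableOn_image_iff_integrableOn_abs_deriv_smul MeasurableSet.univ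
      (fun x _ => (hF' x).hasDerivWithinAt) hinj, heq]
    exact hI.integrableOn
  · rw [← himg, integral_image_eq_integral_abs_deriv_smul MeasurableSet.univ
      (fun x _ => (hF' x).hasDerivWithinAt) hinj, heq, setIntegral_univ]
end

section
/- Let Y be an integrable real-valued random variable on a probability space with cumulative distribution function F(s) = P(Y ≤ s), and let ψ : [0,1] → ℝ be bounded and Borel measurable. Then the random variable e = ∫_ℝ ( F(s) − 1{Y ≤ s} ) ψ(F(s)) ds is well defined (the integral converges absolutely almost surely), e is integrable, and E[e] = 0. -/
open MeasureTheory Set Filter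

/-- The influence-function adjustment term
`e = ∫_ℝ (F(s) - 1{Y ≤ s}) ψ(F(s)) ds` (with `F` the CDF of the integrable random
variable `Y` and `ψ` bounded measurable) is almost surely absolutely convergent,
integrable, and has mean zero. -/
theorem stmt5
    {Ω : Type*} [MeasurableSpace Ω] (μ : Measure Ω) [IsProbabilityMeasure μ]
    (Y : Ω → ℝ) (hYm : Measurable Y) (hYi : Integrable Y μ)
    (ψ : ℝ → ℝ) (hψm : Measurable ψ)
    (M : ℝ) (hψb : ∀ u ∈ Icc (0:ℝ) 1, |ψ u| ≤ M)
    (F : ℝ → ℝ) (hF : ∀ s, F s = (μ {ω | Y ω ≤ s}).toReal)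
    (e : Ω → ℝ)
    (he : ∀ ω, e ω = ∫ s, (F s - if Y ω ≤ s then (1:ℝ) else 0) * ψ (F s)) :
    (∀ᵐ ω ∂μ,
      Integrable (fun s => (F s - if Y ω ≤ s then (1:ℝ) else 0) * ψ (F s)) volume) ∧
    Integrable e μ ∧
    ∫ ω, e ω ∂μ = 0 := by
  have hS : MeasurableSet {p : Ω × ℝ | Y p.1 ≤ p.2} :=
    measurableSet_le (hYm.comp measurable_fst) measurable_snd
  have hind : Measurable (fun p : Ω × ℝ => if Y p.1 ≤ p.2 then (1:ℝ) else 0) :=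
    Measurable.ite hS measurable_const measurable_const
  have hind0 : Measurable (fun s : ℝ => if 0 ≤ s then (1:ℝ) else 0) :=
    Measurable.ite measurableSet_Ici measurable_const measurable_const
  have hFmono : Monotone F := by
    intro a b hab
    rw [hF, hF]
    exact ENNReal.toReal_mono (measure_ne_top _ _)
      (measure_mono fun ω (h : Y ω ≤ a) => h.trans hab)
  have hFm : Measurable F := hFmono.measurable
  have hF01 : ∀ s, F s ∈ Icc (0:ℝ) 1 := by
    intro s
    rw [hF]
    exact ⟨ENNReal.toReal_nonneg, measureReal_le_one⟩
  have hmeanI : ∀ s, ∫ ω, (if Y ω ≤ s then (1:ℝ) else 0) ∂μ = F s := by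
    intro s
    have hm : MeasurableSet {ω | Y ω ≤ s} := hYm measurableSet_Iic
    have := integral_indicator_one (μ := μ) hm
    rw [hF s]
    rw [← Measure.real, ← this]
    rfl
  have hintI : ∀ s, Integrable (fun ω => if Y ω ≤ s then (1:ℝ) else 0) μ := by
    intro s
    have hm : MeasurableSet {ω | Y ω ≤ s} := hYm measurableSet_Iic
    exact (integrable_const (1:ℝ)).indicator hm
  let g : Ω × ℝ → ℝ := fun p =>
    (if Y p.1 ≤ p.2 then (1:ℝ) else 0) - (if 0 ≤ p.2 then (1:ℝ) else 0)
  have hgm : Measurable g := hind.sub (hind0.comp measurable_snd)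
  have hgn : ∀ ω, (fun s => ‖g (ω, s)‖) =
      (Ico (min 0 (Y ω)) (max 0 (Y ω))).indicator (fun _ => (1:ℝ)) := by
    intro ω
    funext s
    simp only [g, indicator, mem_Ico, min_le_iff, lt_max_iff]
    by_cases h1 : Y ω ≤ s <;> by_cases h2 : 0 ≤ s <;>
      simp [h1, h2, not_lt.mpr, not_le.mp]
  have hgi : Integrable g (μ.prod volume) := by
    rw [integrable_prod_iff hgm.aestronglyMeasurable]
    constructor
    · refine Eventually.of_forall fun ω => ?_
      refine (integrable_norm_iff (f := fun s => g (ω, s)) (hgm.comp measurable_prodMk_left).aestronglyMeasurable).mp ?_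
      change Integrable (fun s => ‖g (ω, s)‖) volume
      rw [hgn ω, integrable_indicator_iff measurableSet_Ico]
      exact integrableOn_const (by simp)
    · have : (fun ω => ∫ s, ‖g (ω, s)‖) = fun ω => |Y ω| := by
        funext ω
        rw [hgn ω, integral_indicator_const _ measurableSet_Ico]
        simp [Measure.real, Real.volume_Ico, max_sub_min_eq_abs]
      rw [this]
      exact hYi.abs
  let G : ℝ → ℝ := fun s => F s - (if 0 ≤ s then (1:ℝ) else 0)
  have hG : Integrable G volume := by
    have h := hgi.integral_prod_right
    refine h.congr (Eventually.of_forall fun s => ?_)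
    change ∫ ω, ((if Y ω ≤ s then (1:ℝ) else 0) - (if 0 ≤ s then (1:ℝ) else 0)) ∂μ =
      F s - (if 0 ≤ s then (1:ℝ) else 0)
    generalize (if 0 ≤ s then (1:ℝ) else 0) = c
    rw [integral_sub (hintI s) (integrable_const c), hmeanI]
    simp
  let f : Ω × ℝ → ℝ := fun p => (F p.2 - if Y p.1 ≤ p.2 then (1:ℝ) else 0) * ψ (F p.2)
  have hf : Integrable f (μ.prod volume) := by
    have h1 : Integrable (fun p : Ω × ℝ => G p.2 - g p) (μ.prod volume) :=
      (hG.comp_snd μ).sub hgi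
    have h2 := h1.mul_bdd (g := fun p : Ω × ℝ => ψ (F p.2)) (c := M)
      ((hψm.comp (hFm.comp measurable_snd)).aestronglyMeasurable)
      (Eventually.of_forall fun p => hψb _ (hF01 _))
    refine h2.congr (Eventually.of_forall fun p => ?_)
    simp only [f, g, G]
    ring
  have hee : e = fun ω => ∫ s, f (ω, s) := funext he
  refine ⟨hf.prod_right_ae, ?_, ?_⟩
  · rw [hee]
    exact hf.integral_prod_left
  · rw [hee]
    rw [integral_integral_swap (f := fun ω s => f (ω, s)) hf]
    have : ∀ s, ∫ ω, f (ω, s) ∂μ = 0 := by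
      intro s
      change ∫ ω, (F s - if Y ω ≤ s then (1:ℝ) else 0) * ψ (F s) ∂μ = 0
      rw [integral_mul_const, integral_sub (integrable_const _) (hintI s), hmeanI]
      simp
    simp [this]
end

section
/- Let ρ be a Borel probability measure on ℝ^p × ℝ with first-marginal ρ_X, and let F(s|x) be a regular conditional CDF for ρ. Let ψ : [0,1] → ℝ be bounded and Borel measurable, and suppose the map (x, y) ↦ ‖x‖ · ∫_ℝ | F(s|x) − 1{y ≤ s} | ds is ρ-integrable. Then ∫_{ℝ^p × ℝ} x · ( ∫_ℝ ( F(s|x) − 1{y ≤ s} ) ψ(F(s|x)) ds ) dρ(x, y) = 0 in ℝ^p. -/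
open MeasureTheory Set Filter

theorem aux_fiber (ν : Measure ℝ) [IsProbabilityMeasure ν] (G : ℝ → ℝ)
    (hG : ∀ s, ν.real (Iic s) = G s) (hGm : Measurable G) (ψ : ℝ → ℝ) (hψm : Measurable ψ)
    (M : ℝ) (hψb : ∀ u ∈ Icc (0:ℝ) 1, |ψ u| ≤ M) :
    ∫ y, (∫ s, (G s - if y ≤ s then (1:ℝ) else 0) * ψ (G s)) ∂ν = 0 := by
  have h0 : ∀ s, 0 ≤ G s := fun s => by rw [← hG]; exact measureReal_nonneg
  have h1 : ∀ s, G s ≤ 1 := fun s => by rw [← hG]; exact measureReal_le_one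
  have hind : ∀ s : ℝ, (fun y : ℝ => if y ≤ s then (1:ℝ) else 0) = (Iic s).indicator 1 := by
    intro s; ext y; simp [indicator]
  have hii : ∀ s : ℝ, Integrable (fun y : ℝ => if y ≤ s then (1:ℝ) else 0) ν := by
    intro s; rw [hind]; exact (integrable_const (1:ℝ)).indicator measurableSet_Iic
  have hiv : ∀ s : ℝ, ∫ y, (if y ≤ s then (1:ℝ) else 0) ∂ν = G s := by
    intro s; rw [hind, integral_indicator_one measurableSet_Iic, hG]
  have hm : Measurable (fun q : ℝ × ℝ => (G q.2 - if q.1 ≤ q.2 then (1:ℝ) else 0) * ψ (G q.2)) := by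
    refine Measurable.mul (Measurable.sub (by fun_prop) ?_) (by fun_prop)
    exact Measurable.ite (measurableSet_le measurable_fst measurable_snd)
      measurable_const measurable_const
  by_cases hex : ∃ y₀, Integrable fun s => (G s - if y₀ ≤ s then (1:ℝ) else 0) * ψ (G s)
  · obtain ⟨y₀, hy₀⟩ := hex
    have hI : Integrable (Function.uncurry fun y s : ℝ =>
        (G s - if y ≤ s then (1:ℝ) else 0) * ψ (G s)) (ν.prod volume) := by
      refine (integrable_prod_iff' hm.aestronglyMeasurable).2 ⟨?_, ?_⟩
      · refine Eventually.of_forall fun s => ?_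
        exact ((integrable_const (G s)).sub (hii s)).mul_const (ψ (G s))
      · have heq : ∀ s, ∫ y, ‖Function.uncurry (fun y s : ℝ =>
            (G s - if y ≤ s then (1:ℝ) else 0) * ψ (G s)) (y, s)‖ ∂ν
            = 2 * G s * (1 - G s) * |ψ (G s)| := by
          intro s
          have : ∀ y, ‖Function.uncurry (fun y s : ℝ =>
            (G s - if y ≤ s then (1:ℝ) else 0) * ψ (G s)) (y, s)‖
            = (G s + (1 - 2 * G s) * (if y ≤ s then (1:ℝ) else 0)) * |ψ (G s)| := by
            intro y
            simp only [Function.uncurry, norm_mul, Real.norm_eq_abs]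
            congr 1
            split_ifs
            · rw [abs_of_nonpos (by linarith [h1 s])]; ring
            · rw [abs_of_nonneg (by linarith [h0 s])]; ring
          simp_rw [this]
          rw [integral_mul_const, integral_add (integrable_const _) ((hii s).const_mul _),
            integral_const_mul, hiv]
          simp
          left; ring
        refine Integrable.congr ?_ (Eventually.of_forall fun s => (heq s).symm)
        refine (hy₀.norm.const_mul 2).mono' ?_ (Eventually.of_forall fun s => ?_)
        · exact Measurable.aestronglyMeasurable (by fun_prop)
        · have a0 := h0 s
          have a1 := h1 s
          have b : 0 ≤ 1 - G s := by linarith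
          rw [Real.norm_of_nonneg (by positivity), norm_mul, Real.norm_eq_abs, Real.norm_eq_abs,
            ← mul_assoc]
          refine mul_le_mul_of_nonneg_right ?_ (abs_nonneg _)
          split_ifs
          · rw [abs_of_nonpos (by linarith)]; nlinarith
          · rw [abs_of_nonneg (by linarith)]; nlinarith
    rw [integral_integral_swap hI]
    refine integral_eq_zero_of_ae (Eventually.of_forall fun s => ?_)
    simp only [Pi.zero_apply]
    rw [integral_mul_const, integral_sub (integrable_const _) (hii s), hiv]
    simp
  · push Not at hex
    simp_rw [fun y => integral_undef (hex y)]
    simp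

/-- `E[X e] = 0` for the residual
`e = ∫_ℝ (F(s|X) - 1{Y ≤ s}) ψ(F(s|X)) ds` of the weighted-average quantile
regression, where `F(s|x)` is a regular conditional CDF for the joint law `ρ` of
`(X, Y)` and `ψ` is bounded and measurable. -/
theorem stmt6
    {p : ℕ} (ρ : Measure ((Fin p → ℝ) × ℝ)) [IsProbabilityMeasure ρ]
    (F : ℝ → (Fin p → ℝ) → ℝ)
    (hFmeas : Measurable fun q : ℝ × (Fin p → ℝ) => F q.1 q.2)
    (hFmono : ∀ x, Monotone fun s => F s x)
    (hFrc : ∀ x s, ContinuousWithinAt (fun s' => F s' x) (Ici s) s)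
    (hF0 : ∀ x, Tendsto (fun s => F s x) atBot (nhds 0))
    (hF1 : ∀ x, Tendsto (fun s => F s x) atTop (nhds 1))
    (hdis : ∀ A : Set (Fin p → ℝ), MeasurableSet A → ∀ s : ℝ,
      ρ (A ×ˢ Iic s) = ∫⁻ x in A, ENNReal.ofReal (F s x) ∂(ρ.map Prod.fst))
    (ψ : ℝ → ℝ) (hψm : Measurable ψ)
    (M : ℝ) (hψb : ∀ u ∈ Icc (0:ℝ) 1, |ψ u| ≤ M)
    (hint : Integrable (fun z : (Fin p → ℝ) × ℝ =>
      ‖z.1‖ * ∫ s, |F s z.1 - if z.2 ≤ s then (1:ℝ) else 0|) ρ) :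
    ∫ z : (Fin p → ℝ) × ℝ,
      (∫ s, (F s z.1 - if z.2 ≤ s then (1:ℝ) else 0) * ψ (F s z.1)) • z.1 ∂ρ = 0 := by
  by_cases hI : Integrable (fun z : (Fin p → ℝ) × ℝ =>
      (∫ s, (F s z.1 - if z.2 ≤ s then (1:ℝ) else 0) * ψ (F s z.1)) • z.1) ρ
  swap
  · exact integral_undef hI
  have hd : ρ.fst.compProd ρ.condKernel = ρ := ρ.disintegrate ρ.condKernel
  have hF0' : ∀ x s, 0 ≤ F s x := fun x s => (hFmono x).le_of_tendsto (hF0 x) s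
  have hrat : ∀ᵐ x ∂ρ.fst, ∀ q : ℚ, ρ.condKernel x (Iic (q:ℝ)) = ENNReal.ofReal (F q x) := by
    rw [ae_all_iff]
    intro q
    refine ae_eq_of_forall_setLIntegral_eq_of_sigmaFinite
      (ρ.condKernel.measurable_coe measurableSet_Iic) ?_ ?_
    · exact (hFmeas.comp (measurable_const.prodMk measurable_id)).ennreal_ofReal
    · intro A hA _
      rw [← Measure.compProd_apply_prod hA measurableSet_Iic, hd, hdis A hA]
      rfl
  have hall : ∀ᵐ x ∂ρ.fst, ∀ s : ℝ, (ρ.condKernel x).real (Iic s) = F s x := by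
    filter_upwards [hrat] with x hx s
    let f : StieltjesFunction ℝ := ⟨fun s => F s x, hFmono x, hFrc x⟩
    have hq : ∀ q : ℚ, ProbabilityTheory.cdf (ρ.condKernel x) q = f q := by
      intro q
      rw [ProbabilityTheory.cdf_eq_real, measureReal_def, hx q, ENNReal.toReal_ofReal (hF0' x q)]
    rw [← ProbabilityTheory.cdf_eq_real]
    change _ = f s
    rw [← StieltjesFunction.iInf_rat_gt_eq, ← StieltjesFunction.iInf_rat_gt_eq]
    simp_rw [hq]
  have key : ∀ f : (Fin p → ℝ) × ℝ → (Fin p → ℝ), Integrable f ρ →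
      ∫ z, f z ∂ρ = ∫ x, (∫ y, f (x, y) ∂(ρ.condKernel x)) ∂ρ.fst := by
    intro f hf
    conv_lhs => rw [← hd]
    exact Measure.integral_compProd (by rwa [hd])
  rw [key _ hI]
  refine integral_eq_zero_of_ae ?_
  filter_upwards [hall] with x hx
  simp only [Pi.zero_apply]
  rw [integral_smul_const, aux_fiber (ρ.condKernel x) (fun s => F s x) hx
    (hFmeas.comp (measurable_id.prodMk measurable_const)) ψ hψm M hψb, zero_smul]
end

section
/- Let ψ : [0,1] → ℝ be nondecreasing and set Ψ(t) = ∫_0^t ψ(u) du. Let F, G : ℝ → [0,1] be Borel measurable with ∫_ℝ |F(s) − G(s)| ds < ∞. Then the function s ↦ Ψ(F(s)) − Ψ(G(s)) + (G(s) − F(s)) ψ(G(s)) is Lebesgue integrable on ℝ and | ∫_ℝ [ Ψ(F(s)) − Ψ(G(s)) + (G(s) − F(s)) ψ(G(s)) ] ds | ≤ ∫_ℝ |G(s) − F(s)| · |ψ(G(s)) − ψ(F(s))| ds. -/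
open MeasureTheory Set

/-- Integrated second-order bound: for `ψ` nondecreasing on `[0,1]`,
`Ψ(t) = ∫_0^t ψ`, and measurable `F, G : ℝ → [0,1]` with `∫ |F - G| < ∞`,
the bias term `s ↦ Ψ(F s) - Ψ(G s) + (G s - F s) ψ(G s)` is integrable and
`|∫ [Ψ(F) - Ψ(G) + (G - F) ψ(G)]| ≤ ∫ |G - F| ⬝ |ψ(G) - ψ(F)|`. -/
theorem stmt9
    (ψ : ℝ → ℝ) (hψ : MonotoneOn ψ (Icc 0 1))
    (Ψ : ℝ → ℝ) (hΨ : ∀ t, Ψ t = ∫ u in (0:ℝ)..t, ψ u)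
    (F G : ℝ → ℝ) (hFm : Measurable F) (hGm : Measurable G)
    (hFr : ∀ s, F s ∈ Icc (0:ℝ) 1) (hGr : ∀ s, G s ∈ Icc (0:ℝ) 1)
    (hint : Integrable (fun s => |F s - G s|) volume) :
    Integrable (fun s => Ψ (F s) - Ψ (G s) + (G s - F s) * ψ (G s)) volume ∧
    |∫ s, (Ψ (F s) - Ψ (G s) + (G s - F s) * ψ (G s))| ≤
      ∫ s, |G s - F s| * |ψ (G s) - ψ (F s)| := by
  obtain ⟨φ, hφ, hφψ, hφb⟩ : ∃ φ : ℝ → ℝ, Monotone φ ∧ (∀ x ∈ Icc (0:ℝ) 1, φ x = ψ x) ∧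
      ∀ x y, |φ x - φ y| ≤ ψ 1 - ψ 0 := by
    have hm : ∀ x : ℝ, max 0 (min 1 x) ∈ Icc (0:ℝ) 1 := fun x =>
      ⟨le_max_left _ _, max_le zero_le_one (min_le_left _ _)⟩
    refine ⟨fun x => ψ (max 0 (min 1 x)), ?_, ?_, ?_⟩
    · intro x y hxy
      exact hψ (hm x) (hm y) (max_le_max le_rfl (min_le_min le_rfl hxy))
    · intro x hx
      simp only [min_eq_right hx.2, max_eq_right hx.1]
    · intro x y
      have h0 : (0:ℝ) ∈ Icc (0:ℝ) 1 := by simp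
      have h1 : (1:ℝ) ∈ Icc (0:ℝ) 1 := by simp
      have a1 := hψ h0 (hm x) (hm x).1
      have a2 := hψ (hm x) h1 (hm x).2
      have a3 := hψ h0 (hm y) (hm y).1
      have a4 := hψ (hm y) h1 (hm y).2
      rw [abs_le]
      constructor <;> linarith
  have hii : ∀ a b : ℝ, IntervalIntegrable φ volume a b := fun a b => hφ.intervalIntegrable
  have hΨφ : ∀ t ∈ Icc (0:ℝ) 1, Ψ t = ∫ u in (0:ℝ)..t, φ u := by
    intro t ht
    rw [hΨ]
    apply intervalIntegral.integral_congr
    intro u hu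
    rw [uIcc_of_le ht.1] at hu
    exact (hφψ u ⟨hu.1, hu.2.trans ht.2⟩).symm
  have hcont : Continuous (fun t => ∫ u in (0:ℝ)..t, φ u) :=
    intervalIntegral.continuous_primitive hii 0
  have e1 : (fun s => Ψ (F s) - Ψ (G s) + (G s - F s) * ψ (G s)) = fun s =>
      (∫ u in (0:ℝ)..(F s), φ u) - (∫ u in (0:ℝ)..(G s), φ u) + (G s - F s) * φ (G s) := by
    funext s
    rw [hΨφ _ (hFr s), hΨφ _ (hGr s), hφψ _ (hGr s)]
  have e2 : (fun s => |G s - F s| * |ψ (G s) - ψ (F s)|) = fun s =>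
      |G s - F s| * |φ (G s) - φ (F s)| := by
    funext s
    rw [hφψ _ (hFr s), hφψ _ (hGr s)]
  rw [e1, e2]
  have key : ∀ a b : ℝ, |(∫ u in (0:ℝ)..a, φ u) - (∫ u in (0:ℝ)..b, φ u) + (b - a) * φ b| ≤
      |b - a| * |φ b - φ a| := by
    intro a b
    have h : (∫ u in (0:ℝ)..a, φ u) - (∫ u in (0:ℝ)..b, φ u) + (b - a) * φ b
        = ∫ u in b..a, (φ u - φ b) := by
      rw [intervalIntegral.integral_sub (hii _ _) (by simp),
        intervalIntegral.integral_interval_sub_left (hii _ _) (hii _ _),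
        intervalIntegral.integral_const, smul_eq_mul]
      ring
    rw [h, mul_comm, abs_sub_comm b a, ← Real.norm_eq_abs]
    apply intervalIntegral.norm_integral_le_of_norm_le_const
    intro u hu
    rw [Real.norm_eq_abs]
    rcases le_total b a with hba | hba
    · rw [uIoc_of_le hba] at hu
      have h1 := hφ hu.1.le
      have h2 := hφ hu.2
      rw [abs_of_nonneg (by linarith), abs_of_nonpos (by linarith)]
      linarith
    · rw [uIoc_of_ge hba] at hu
      have h1 := hφ hu.1.le
      have h2 := hφ hu.2
      rw [abs_of_nonpos (by linarith), abs_of_nonneg (by linarith)]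
      linarith
  have hφm := hφ.measurable
  have hR : Integrable (fun s => |G s - F s| * |φ (G s) - φ (F s)|) volume := by
    refine (hint.mul_const (ψ 1 - ψ 0)).mono' (by fun_prop) (ae_of_all _ fun s => ?_)
    rw [Real.norm_eq_abs, abs_mul, abs_abs, abs_abs, abs_sub_comm (G s)]
    exact mul_le_mul_of_nonneg_left (hφb _ _) (abs_nonneg _)
  have hm : Measurable (fun s =>
      (∫ u in (0:ℝ)..(F s), φ u) - (∫ u in (0:ℝ)..(G s), φ u) + (G s - F s) * φ (G s)) :=
    ((hcont.measurable.comp hFm).sub (hcont.measurable.comp hGm)).add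
      ((hGm.sub hFm).mul (hφm.comp hGm))
  refine ⟨hR.mono' hm.aestronglyMeasurable (ae_of_all _ fun s => key _ _), ?_⟩
  rw [← Real.norm_eq_abs]
  exact norm_integral_le_of_norm_le hR (ae_of_all _ fun s => key (F s) (G s))
end

section
/- Let ψ₁ : ℝ → [0, M] be nondecreasing (M < ∞), let s₁ < s₂ be real numbers, let F : ℝ → ℝ be continuously differentiable on [s₁, s₂] with F'(s) ≥ c > 0 for all s ∈ [s₁, s₂], let δ ≥ 0, and let G : ℝ → ℝ satisfy |G(s) − F(s)| ≤ δ for all s ∈ [s₁, s₂]. Then ∫_{s₁}^{s₂} | ψ₁(G(s)) − ψ₁(F(s)) | ds ≤ 2 δ M / c. -/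
open MeasureTheory Set

/-- Middle-interval bound: if `ψ₁ : ℝ → [0, M]` is nondecreasing, `F` is continuously
differentiable on `[s₁, s₂]` with derivative at least `c > 0` there, and
`|G - F| ≤ δ` on `[s₁, s₂]`, then `∫_{s₁}^{s₂} |ψ₁(G) - ψ₁(F)| ≤ 2 δ M / c`. -/
theorem stmt10
    (M : ℝ) (ψ₁ : ℝ → ℝ) (hψ_mono : Monotone ψ₁) (hψ_range : ∀ x, ψ₁ x ∈ Icc (0:ℝ) M)
    (s₁ s₂ : ℝ) (hs : s₁ < s₂)
    (F f G : ℝ → ℝ) (c δ : ℝ) (hc : 0 < c) (hδ : 0 ≤ δ)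
    (hF' : ∀ s ∈ Icc s₁ s₂, HasDerivAt F (f s) s)
    (hf_cont : ContinuousOn f (Icc s₁ s₂))
    (hf_lb : ∀ s ∈ Icc s₁ s₂, c ≤ f s)
    (hGm : Measurable G)
    (hG : ∀ s ∈ Icc s₁ s₂, |G s - F s| ≤ δ) :
    ∫ s in s₁..s₂, |ψ₁ (G s) - ψ₁ (F s)| ≤ 2 * δ * M / c := by
  have hcont : ContinuousOn F (Icc s₁ s₂) := fun s h => (hF' s h).continuousAt.continuousWithinAt
  have hd : ∀ x ∈ Ioo s₁ s₂, HasDerivAt F (f x) x := fun x hx => hF' x (Ioo_subset_Icc_self hx)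
  have hn : ∀ x ∈ Ioo s₁ s₂, 0 ≤ f x := fun x hx => hc.le.trans (hf_lb x (Ioo_subset_Icc_self hx))
  have hab : F s₁ ≤ F s₂ := by
    obtain ⟨x, hx, h⟩ := exists_hasDerivAt_eq_slope F f hs hcont hd
    have h1 := hn x hx
    rw [h] at h1
    have h2 : 0 < s₂ - s₁ := sub_pos.2 hs
    have := mul_nonneg h1 h2.le
    rw [div_mul_cancel₀ _ h2.ne'] at this
    linarith
  set φ : ℝ → ℝ := fun z => ψ₁ (z + δ) - ψ₁ (z - δ) with hφ
  have m1 : Monotone (fun z => ψ₁ (z + δ)) := fun a b h => hψ_mono (by linarith)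
  have m2 : Monotone (fun z => ψ₁ (z - δ)) := fun a b h => hψ_mono (by linarith)
  have hφi : IntervalIntegrable φ volume (F s₁) (F s₂) :=
    m1.intervalIntegrable.sub m2.intervalIntegrable
  have hint : IntegrableOn (fun x => f x • φ (F x)) (Icc s₁ s₂) := by
    rw [integrableOn_Icc_deriv_smul_iff_of_deriv_nonneg hcont hd hn hs.le]
    exact (intervalIntegrable_iff_integrableOn_Icc_of_le hab).1 hφi
  have hval : ∫ x in Icc s₁ s₂, f x • φ (F x) = ∫ z in (F s₁)..(F s₂), φ z := by
    rw [integral_Icc_deriv_smul_of_deriv_nonneg hcont hd hn hs.le,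
      intervalIntegral.integral_of_le hab, integral_Icc_eq_integral_Ioc]
  have ii : ∀ a b, IntervalIntegrable ψ₁ volume a b := fun a b => hψ_mono.intervalIntegrable
  have hφv : ∫ z in (F s₁)..(F s₂), φ z ≤ 2 * δ * M := by
    rw [hφ, intervalIntegral.integral_sub m1.intervalIntegrable m2.intervalIntegrable,
      intervalIntegral.integral_comp_add_right, intervalIntegral.integral_comp_sub_right,
      intervalIntegral.integral_interval_sub_interval_comm' (ii _ _) (ii _ _) (ii _ _)]
    have h1 : ∫ z in (F s₂ - δ)..(F s₂ + δ), ψ₁ z ≤ ∫ z in (F s₂ - δ)..(F s₂ + δ), M :=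
      intervalIntegral.integral_mono_on (by linarith) (ii _ _) (by simp)
        (fun x _ => (hψ_range x).2)
    have h2 : 0 ≤ ∫ z in (F s₁ - δ)..(F s₁ + δ), ψ₁ z :=
      intervalIntegral.integral_nonneg (by linarith) (fun x _ => (hψ_range x).1)
    simp only [intervalIntegral.integral_const, smul_eq_mul] at h1
    linarith
  have hmain : ∫ s in Icc s₁ s₂, |ψ₁ (G s) - ψ₁ (F s)| ≤
      ∫ s in Icc s₁ s₂, (1 / c) * (f s • φ (F s)) := by
    apply integral_mono_of_nonneg
    · exact Filter.Eventually.of_forall fun s => abs_nonneg _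
    · exact hint.const_mul _
    · filter_upwards [ae_restrict_mem measurableSet_Icc] with s h
      have hg := abs_le.1 (hG s h)
      have a1 : ψ₁ (G s) ≤ ψ₁ (F s + δ) := hψ_mono (by linarith)
      have a2 : ψ₁ (F s - δ) ≤ ψ₁ (G s) := hψ_mono (by linarith)
      have a3 : ψ₁ (F s) ≤ ψ₁ (F s + δ) := hψ_mono (by linarith)
      have a4 : ψ₁ (F s - δ) ≤ ψ₁ (F s) := hψ_mono (by linarith)
      have a5 : |ψ₁ (G s) - ψ₁ (F s)| ≤ φ (F s) := by
        simp only [hφ]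
        exact abs_le.2 ⟨by linarith, by linarith⟩
      have a6 : 0 ≤ φ (F s) := (abs_nonneg _).trans a5
      refine a5.trans ?_
      rw [smul_eq_mul, one_div, inv_mul_eq_div, le_div_iff₀ hc, mul_comm]
      exact mul_le_mul_of_nonneg_right (hf_lb s h) a6
  rw [intervalIntegral.integral_of_le hs.le, ← integral_Icc_eq_integral_Ioc]
  refine hmain.trans ?_
  rw [integral_const_mul, hval, one_div, inv_mul_eq_div]
  exact div_le_div_of_nonneg_right hφv hc.le
end

section
/- Let 0 < u₀ < 1/2, c > 0, and s₁ < s₂. Let ψ : [0,1] → ℝ have bounded variation and be Lipschitz on [0, u₀] and on [1 − u₀, 1]. Let F : ℝ → [0,1] be nondecreasing with F(s₁) < u₀/2 and F(s₂) > 1 − u₀/2, and continuously differentiable on [s₁, s₂] with derivative at least c there. Then there exists a constant C < ∞, depending only on ψ, u₀, and c, such that for every Borel measurable G : ℝ → [0,1] with sup_{s ∈ ℝ} |G(s) − F(s)| ≤ u₀/2, ∫_ℝ | ψ(G(s)) − ψ(F(s)) | ds ≤ C ( sup_{s ∈ ℝ} |G(s) − F(s)| + ∫_ℝ |G(s) −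 F(s)| ds ). -/
open MeasureTheory Set

lemma aux_shift (H : ℝ → ℝ) (hH : Monotone H) (A B : ℝ) (hA : ∀ x, A ≤ H x) (hB : ∀ x, H x ≤ B)
    (δ : ℝ) (hδ : 0 ≤ δ) :
    ∫⁻ u in Icc (0:ℝ) 1, ENNReal.ofReal (H (u + δ) - H (u - δ)) ≤
      ENNReal.ofReal (2 * δ * (B - A)) := by
  have hi : ∀ a b : ℝ, IntervalIntegrable H volume a b := fun a b => hH.intervalIntegrable
  have hp : Monotone (fun u => H (u + δ)) := fun x y h => hH (by linarith)
  have hm : Monotone (fun u => H (u - δ)) := fun x y h => hH (by linarith)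
  have hint : IntervalIntegrable (fun u => H (u + δ) - H (u - δ)) volume 0 1 :=
    hp.intervalIntegrable.sub hm.intervalIntegrable
  have hint' : IntegrableOn (fun u => H (u + δ) - H (u - δ)) (Icc 0 1) volume := by
    rw [integrableOn_Icc_iff_integrableOn_Ioc]
    exact (intervalIntegrable_iff_integrableOn_Ioc_of_le zero_le_one).1 hint
  rw [← ofReal_integral_eq_lintegral_ofReal hint'
    (Filter.Eventually.of_forall fun u => sub_nonneg.2 (hH (by linarith)))]
  apply ENNReal.ofReal_le_ofReal
  rw [integral_Icc_eq_integral_Ioc, ← intervalIntegral.integral_of_le zero_le_one,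
    intervalIntegral.integral_sub hp.intervalIntegrable hm.intervalIntegrable,
    intervalIntegral.integral_comp_add_right (fun u => H u),
    intervalIntegral.integral_comp_sub_right (fun u => H u)]
  have e1 := intervalIntegral.integral_add_adjacent_intervals (hi (0 - δ) (0 + δ)) (hi (0 + δ) (1 + δ))
  have e2 := intervalIntegral.integral_add_adjacent_intervals (hi (0 - δ) (1 - δ)) (hi (1 - δ) (1 + δ))
  have b1 : ∫ x in (1 - δ)..(1 + δ), H x ≤ ∫ x in (1 - δ)..(1 + δ), B :=
    intervalIntegral.integral_mono_on (by linarith) (hi _ _) (by simp) (fun x _ => hB x)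
  have b2 : ∫ x in (0 - δ)..(0 + δ), A ≤ ∫ x in (0 - δ)..(0 + δ), H x :=
    intervalIntegral.integral_mono_on (by linarith) (by simp) (hi _ _) (fun x _ => hA x)
  rw [intervalIntegral.integral_const, smul_eq_mul] at b1 b2
  nlinarith

lemma aux_cov (H : ℝ → ℝ) (hH : Monotone H) (A B : ℝ) (hA : ∀ x, A ≤ H x) (hB : ∀ x, H x ≤ B)
    (δ : ℝ) (hδ : 0 ≤ δ) (c : ℝ) (hc : 0 < c) (s₁ s₂ : ℝ) (F f : ℝ → ℝ)
    (hF : ∀ s, F s ∈ Icc (0:ℝ) 1)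
    (hd : ∀ s ∈ Icc s₁ s₂, HasDerivAt F (f s) s)
    (hf : ∀ s ∈ Icc s₁ s₂, c ≤ f s) :
    ∫⁻ s in Icc s₁ s₂, ENNReal.ofReal (H (F s + δ) - H (F s - δ)) ≤
      ENNReal.ofReal (2 * (B - A) / c) * ENNReal.ofReal δ := by
  have hAB : A ≤ B := (hA 0).trans (hB 0)
  have hinj : InjOn F (Icc s₁ s₂) := by
    apply StrictMonoOn.injOn
    apply strictMonoOn_of_deriv_pos (convex_Icc _ _)
    · exact fun s hs => (hd s hs).continuousAt.continuousWithinAt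
    · intro s hs
      have hs' := interior_subset hs
      rw [(hd s hs').deriv]
      exact hc.trans_le (hf s hs')
  have cov := lintegral_image_eq_lintegral_abs_deriv_mul (measurableSet_Icc (a := s₁) (b := s₂))
    (fun s hs => (hd s hs).hasDerivWithinAt) hinj
    (fun u => ENNReal.ofReal (H (u + δ) - H (u - δ)))
  have h1 : ENNReal.ofReal c * ∫⁻ s in Icc s₁ s₂, ENNReal.ofReal (H (F s + δ) - H (F s - δ)) ≤
      ENNReal.ofReal (2 * δ * (B - A)) := by
    rw [← lintegral_const_mul' _ _ ENNReal.ofReal_ne_top]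
    calc _ ≤ ∫⁻ s in Icc s₁ s₂, ENNReal.ofReal |f s| *
          ENNReal.ofReal (H (F s + δ) - H (F s - δ)) := by
            apply setLIntegral_mono' measurableSet_Icc
            intro s hs
            gcongr
            exact (hf s hs).trans (le_abs_self _)
      _ = _ := cov.symm
      _ ≤ _ := lintegral_mono_set (by rintro _ ⟨s, _, rfl⟩; exact hF s)
      _ ≤ _ := aux_shift H hH A B hA hB δ hδ
  have h2 : ENNReal.ofReal (2 * (B - A) / c) * ENNReal.ofReal δ =
      (ENNReal.ofReal c)⁻¹ * ENNReal.ofReal (2 * δ * (B - A)) := by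
    rw [← ENNReal.ofReal_inv_of_pos hc, ← ENNReal.ofReal_mul (inv_nonneg.2 hc.le),
      ← ENNReal.ofReal_mul (show 0 ≤ 2 * (B - A) / c from div_nonneg (by linarith) hc.le)]
    congr 1
    field_simp
  rw [h2]
  have hc0 : ENNReal.ofReal c ≠ 0 := by simpa using hc
  calc _ = (ENNReal.ofReal c)⁻¹ * (ENNReal.ofReal c *
        ∫⁻ s in Icc s₁ s₂, ENNReal.ofReal (H (F s + δ) - H (F s - δ))) := by
          rw [← mul_assoc, ENNReal.inv_mul_cancel hc0 ENNReal.ofReal_ne_top, one_mul]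
    _ ≤ _ := by gcongr

/-- Deterministic content of the paper's Lemma A.1: for a bounded-variation weight `ψ`
that is Lipschitz near the ends of `[0,1]`, there is a constant `C` (depending only on
`ψ`, `u₀`, `c`) such that for any distribution function `F` with density at least `c`
on `[s₁, s₂]` and tails controlled by `u₀`, and any estimate `G` with
`sup |G - F| ≤ u₀/2`, the integrated discrepancy `∫ |ψ(G) - ψ(F)|` is bounded by
`C (sup_s |G(s) - F(s)| + ∫ |G - F|)`. -/
theorem stmt11
    (u₀ c : ℝ) (hu₀ : 0 < u₀) (hu₀' : u₀ < 1/2) (hc : 0 < c)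
    (ψ : ℝ → ℝ)
    (hBV : ∃ ψa ψb : ℝ → ℝ, MonotoneOn ψa (Icc 0 1) ∧ MonotoneOn ψb (Icc 0 1) ∧
      ∀ u ∈ Icc (0:ℝ) 1, ψ u = ψa u - ψb u)
    (hLip : ∃ K : NNReal, LipschitzOnWith K ψ (Icc 0 u₀) ∧
      LipschitzOnWith K ψ (Icc (1 - u₀) 1)) :
    ∃ C : NNReal, ∀ s₁ s₂ : ℝ, s₁ < s₂ → ∀ F f : ℝ → ℝ,
      Monotone F → (∀ s, F s ∈ Icc (0:ℝ) 1) →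
      F s₁ < u₀ / 2 → 1 - u₀ / 2 < F s₂ →
      (∀ s ∈ Icc s₁ s₂, HasDerivAt F (f s) s) →
      ContinuousOn f (Icc s₁ s₂) →
      (∀ s ∈ Icc s₁ s₂, c ≤ f s) →
      ∀ G : ℝ → ℝ, Measurable G → (∀ s, G s ∈ Icc (0:ℝ) 1) →
        (∀ s, |G s - F s| ≤ u₀ / 2) →
        ∫⁻ s, ENNReal.ofReal |ψ (G s) - ψ (F s)| ≤
          (C : ENNReal) *
            ((⨆ s : ℝ, ENNReal.ofReal |G s - F s|) +
              ∫⁻ s, ENNReal.ofReal |G s - F s|) := by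
  obtain ⟨a, b, ha, hb, hab⟩ := hBV
  obtain ⟨K, hK1, hK2⟩ := hLip
  set p : ℝ → ℝ := fun x => max 0 (min 1 x) with hp
  have pm : Monotone p := fun x y h => max_le_max le_rfl (min_le_min le_rfl h)
  have pI : ∀ x, p x ∈ Icc (0:ℝ) 1 := fun x => ⟨le_max_left _ _, max_le zero_le_one (min_le_left _ _)⟩
  have pe : ∀ x ∈ Icc (0:ℝ) 1, p x = x := by
    intro x hx
    simp only [hp]
    rw [min_eq_right hx.2, max_eq_right hx.1]
  have am : Monotone (fun x => a (p x)) := fun x y h => ha (pI x) (pI y) (pm h)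
  have bm : Monotone (fun x => b (p x)) := fun x y h => hb (pI x) (pI y) (pm h)
  set H : ℝ → ℝ := fun x => a (p x) + b (p x) with hHdef
  have hH : Monotone H := am.add bm
  have h0 : (0:ℝ) ∈ Icc (0:ℝ) 1 := by simp
  have h1 : (1:ℝ) ∈ Icc (0:ℝ) 1 := by simp
  have hA : ∀ x, a 0 + b 0 ≤ H x := fun x =>
    add_le_add (ha h0 (pI x) (pI x).1) (hb h0 (pI x) (pI x).1)
  have hB : ∀ x, H x ≤ a 1 + b 1 := fun x =>
    add_le_add (ha (pI x) h1 (pI x).2) (hb (pI x) h1 (pI x).2)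
  refine ⟨K + Real.toNNReal (2 * ((a 1 + b 1) - (a 0 + b 0)) / c), ?_⟩
  intro s₁ s₂ _ F f Fm hF hF1 hF2 hd _ hf G Gm hG hGF
  set S := ⨆ s : ℝ, ENNReal.ofReal |G s - F s| with hS
  have hStop : S ≠ ⊤ := ne_top_of_le_ne_top ENNReal.ofReal_ne_top
    (iSup_le fun s => ENNReal.ofReal_le_ofReal (hGF s))
  set δ := S.toReal with hδdef
  have hδ0 : 0 ≤ δ := ENNReal.toReal_nonneg
  have hδS : ENNReal.ofReal δ = S := ENNReal.ofReal_toReal hStop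
  have hδ : ∀ s, |G s - F s| ≤ δ := fun s =>
    (ENNReal.ofReal_le_iff_le_toReal hStop).1 (le_iSup (fun s => ENNReal.ofReal |G s - F s|) s)
  have key := aux_cov H hH _ _ hA hB δ hδ0 c hc s₁ s₂ F f hF hd hf
  have hmeas : Measurable (fun s => (K : ENNReal) * ENNReal.ofReal |G s - F s|) :=
    ((Gm.sub Fm.measurable).abs.ennreal_ofReal).const_mul _
  have lip : ∀ s, |ψ (G s) - ψ (F s)| ≤ K * |G s - F s| →
      ENNReal.ofReal |ψ (G s) - ψ (F s)| ≤ (K : ENNReal) * ENNReal.ofReal |G s - F s| := by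
    intro s h
    refine (ENNReal.ofReal_le_ofReal h).trans ?_
    rw [ENNReal.ofReal_mul K.coe_nonneg, ENNReal.ofReal_coe_nnreal]
  have pt : ∀ s, ENNReal.ofReal |ψ (G s) - ψ (F s)| ≤
      (K : ENNReal) * ENNReal.ofReal |G s - F s| +
      (Icc s₁ s₂).indicator (fun s => ENNReal.ofReal (H (F s + δ) - H (F s - δ))) s := by
    intro s
    have hg := abs_le.1 (hGF s)
    by_cases c1 : F s < u₀ / 2
    · refine le_add_right (lip s ?_)
      have := hK1.dist_le_mul (G s) ⟨(hG s).1, by linarith⟩ (F s) ⟨(hF s).1, by linarith⟩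
      simpa [Real.dist_eq] using this
    by_cases c2 : 1 - u₀ / 2 < F s
    · refine le_add_right (lip s ?_)
      have := hK2.dist_le_mul (G s) ⟨by linarith, (hG s).2⟩ (F s) ⟨by linarith, (hF s).2⟩
      simpa [Real.dist_eq] using this
    have hs : s ∈ Icc s₁ s₂ := by
      constructor
      · by_contra! h
        exact c1 ((Fm h.le).trans_lt hF1)
      · by_contra! h
        exact c2 (hF2.trans_le (Fm h.le))
    rw [indicator_of_mem hs]
    refine le_add_left (ENNReal.ofReal_le_ofReal ?_)
    have hdl := abs_le.1 (hδ s)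
    have a1 := am (show G s ≤ F s + δ by linarith)
    have a2 := am (show F s - δ ≤ G s by linarith)
    have a3 := am (show F s ≤ F s + δ by linarith)
    have a4 := am (show F s - δ ≤ F s by linarith)
    have b1 := bm (show G s ≤ F s + δ by linarith)
    have b2 := bm (show F s - δ ≤ G s by linarith)
    have b3 := bm (show F s ≤ F s + δ by linarith)
    have b4 := bm (show F s - δ ≤ F s by linarith)
    simp only [pe _ (hG s), pe _ (hF s)] at a1 a2 a3 a4 b1 b2 b3 b4
    rw [hab _ (hG s), hab _ (hF s), abs_le]
    simp only [hHdef]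
    constructor <;> linarith
  calc _ ≤ _ := lintegral_mono pt
    _ = (K : ENNReal) * (∫⁻ s, ENNReal.ofReal |G s - F s|) +
        ∫⁻ s in Icc s₁ s₂, ENNReal.ofReal (H (F s + δ) - H (F s - δ)) := by
      rw [lintegral_add_left hmeas, lintegral_const_mul' _ _ ENNReal.coe_ne_top,
        lintegral_indicator measurableSet_Icc]
    _ ≤ _ := by
      rw [hδS] at key
      rw [ENNReal.coe_add, add_comm S]
      refine add_le_add_right key _ |>.trans ?_
      change _ + ENNReal.ofReal _ * S ≤ (_ + ENNReal.ofReal _) * _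
      rw [add_mul]
      gcongr
      · exact le_self_add
      · exact le_add_self
end

section
/- For all real numbers A > 0 and B > 0, ∫_0^∞ ∫_0^∞ min( A, B s₁^{-4}, B s₂^{-4} ) ds₁ ds₂ ≤ 2 √(A B). -/
open MeasureTheory Set

lemma tail_aux (D c : ℝ) (hD : 0 ≤ D) (hc : 0 < c) (k : ℕ) :
    ∫⁻ s in Ioi c, ENNReal.ofReal (D / s ^ (k + 2)) =
      ENNReal.ofReal (D / ((k + 1) * c ^ (k + 1))) := by
  have hlt : (-((k + 2 : ℕ) : ℝ)) < -1 := by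
    push_cast
    have : (0:ℝ) ≤ k := Nat.cast_nonneg k
    linarith
  have heq : ∀ s ∈ Ioi c, D * s ^ (-((k + 2 : ℕ) : ℝ)) = D / s ^ (k + 2) := by
    intro s hs
    have hs0 : 0 < s := hc.trans hs
    rw [Real.rpow_neg hs0.le, Real.rpow_natCast, div_eq_mul_inv]
  have hint : IntegrableOn (fun s : ℝ => D / s ^ (k + 2)) (Ioi c) :=
    IntegrableOn.congr_fun ((integrableOn_Ioi_rpow_of_lt hlt hc).const_mul D) heq measurableSet_Ioi
  rw [← ofReal_integral_eq_lintegral_ofReal hint]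
  · congr 1
    rw [← setIntegral_congr_fun measurableSet_Ioi heq, integral_const_mul,
      integral_Ioi_rpow_of_lt hlt hc]
    have h1 : (-((k + 2 : ℕ) : ℝ)) + 1 = -((k + 1 : ℕ) : ℝ) := by push_cast; ring
    rw [h1, Real.rpow_neg hc.le, Real.rpow_natCast]
    push_cast
    have h2 : (k : ℝ) + 1 ≠ 0 := by positivity
    field_simp
  · filter_upwards [ae_restrict_mem measurableSet_Ioi] with s hs
    have hs0 : 0 < s := hc.trans hs
    simp only [Pi.zero_apply]
    positivity

lemma bound_aux (h : ℝ → ENNReal) (K D c : ℝ) (hK : 0 ≤ K) (hD : 0 ≤ D) (hc : 0 < c) (k : ℕ)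
    (h1 : ∀ s, 0 < s → s ≤ c → h s ≤ ENNReal.ofReal K)
    (h2 : ∀ s, c < s → h s ≤ ENNReal.ofReal (D / s ^ (k + 2))) :
    ∫⁻ s in Ioi (0:ℝ), h s ≤ ENNReal.ofReal (K * c + D / ((k + 1) * c ^ (k + 1))) := by
  rw [← Ioc_union_Ioi_eq_Ioi hc.le, ENNReal.ofReal_add (by positivity) (by positivity)]
  refine (lintegral_union_le _ _ _).trans (add_le_add ?_ ?_)
  · refine (setLIntegral_mono' measurableSet_Ioc (fun s hs => h1 s hs.1 hs.2)).trans ?_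
    rw [setLIntegral_const, Real.volume_Ioc, sub_zero, ENNReal.ofReal_mul hK]
  · rw [← tail_aux D c hD hc k]
    exact setLIntegral_mono' measurableSet_Ioi (fun s hs => h2 s hs)

/-- Key double-integral bound in the proof of the paper's Lemma A.2:
`∫_0^∞ ∫_0^∞ min(A, B s₁⁻⁴, B s₂⁻⁴) ds₁ ds₂ ≤ 2 √(A B)` for `A, B > 0`. -/
theorem stmt12 (A B : ℝ) (hA : 0 < A) (hB : 0 < B) :
    ∫⁻ s₁ in Ioi (0:ℝ), ∫⁻ s₂ in Ioi (0:ℝ),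
      ENNReal.ofReal (min A (min (B / s₁ ^ 4) (B / s₂ ^ 4))) ≤
      ENNReal.ofReal (2 * Real.sqrt (A * B)) := by
  obtain ⟨c, hc, rfl⟩ : ∃ c : ℝ, 0 < c ∧ B = A * c ^ 4 := by
    refine ⟨√√(B / A), by positivity, ?_⟩
    have : √√(B / A) ^ 4 = B / A := by
      rw [show (4:ℕ) = 2 * 2 from rfl, pow_mul, Real.sq_sqrt (by positivity),
        Real.sq_sqrt (by positivity)]
    rw [this]; field_simp
  have hs : √(A * (A * c ^ 4)) = A * c ^ 2 := by
    rw [show A * (A * c ^ 4) = (A * c ^ 2) ^ 2 by ring, Real.sqrt_sq (by positivity)]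
  rw [hs]
  refine (bound_aux _ (4 / 3 * A * c) (4 / 3 * (A * c ^ 4)) c (by positivity) (by positivity)
    hc 1 ?_ ?_).trans (ENNReal.ofReal_le_ofReal (le_of_eq ?_))
  · intro s hs0 hsc
    refine (bound_aux _ A (A * c ^ 4) c hA.le hB.le hc 2 ?_ ?_).trans
      (ENNReal.ofReal_le_ofReal (le_of_eq ?_))
    · intro t _ _
      exact ENNReal.ofReal_le_ofReal (min_le_left _ _)
    · intro t _
      exact ENNReal.ofReal_le_ofReal ((min_le_right _ _).trans (min_le_right _ _))
    · push_cast
      field_simp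
      norm_num
  · intro s hsc
    have hs0 : 0 < s := hc.trans hsc
    refine (bound_aux _ (A * c ^ 4 / s ^ 4) (A * c ^ 4) s (by positivity) hB.le hs0 2 ?_ ?_).trans
      (ENNReal.ofReal_le_ofReal (le_of_eq ?_))
    · intro t _ _
      exact ENNReal.ofReal_le_ofReal ((min_le_right _ _).trans (min_le_left _ _))
    · intro t _
      exact ENNReal.ofReal_le_ofReal ((min_le_right _ _).trans (min_le_right _ _))
    · push_cast
      field_simp
      norm_num
  · push_cast
    field_simp
    norm_num
end

section
/- For all real numbers x > 0 and t ≥ 0, ∫_0^1 ( x t − x²(4v − 3) )₊ dv equals (3x + t)²/8 if t ≤ x, and equals x² + x t if t ≥ x, where z₊ = max(z, 0). -/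
open MeasureTheory Set

theorem stmt16_aux (x t c : ℝ) :
    ∫ v in (0:ℝ)..c, (x * t - x ^ 2 * (4 * v - 3)) =
      c * (x * t + 3 * x ^ 2) - 2 * x ^ 2 * c ^ 2 := by
  have h : ∀ v ∈ uIcc (0:ℝ) c, HasDerivAt
      (fun v : ℝ => v * (x * t + 3 * x ^ 2) - 2 * x ^ 2 * v ^ 2)
      (x * t - x ^ 2 * (4 * v - 3)) v := by
    intro v _
    have h1 := ((hasDerivAt_id v).mul_const (x * t + 3 * x ^ 2)).sub
      (((hasDerivAt_id v).pow 2).const_mul (2 * x ^ 2))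
    refine h1.congr_deriv ?_
    simp only [id]
    norm_num
    ring
  rw [intervalIntegral.integral_eq_sub_of_hasDerivAt h
    (Continuous.intervalIntegrable (by fun_prop) _ _)]
  ring

/-- Closed-form integral from the paper's Appendix C counterexample:
for `x > 0` and `t ≥ 0`, `∫_0^1 (x t - x²(4v - 3))₊ dv` equals `(3x + t)²/8` if
`t ≤ x`, and equals `x² + x t` if `t ≥ x`. -/
theorem stmt16 (x t : ℝ) (hx : 0 < x) (ht : 0 ≤ t) :
    (t ≤ x →
      ∫ v in (0:ℝ)..1, max (x * t - x ^ 2 * (4 * v - 3)) 0 = (3 * x + t) ^ 2 / 8) ∧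
    (x ≤ t →
      ∫ v in (0:ℝ)..1, max (x * t - x ^ 2 * (4 * v - 3)) 0 = x ^ 2 + x * t) := by
  constructor
  · intro h
    obtain ⟨c, hc⟩ : ∃ c : ℝ, 4 * x * c = t + 3 * x :=
      ⟨(t + 3 * x) / (4 * x), by field_simp⟩
    have hc0 : 0 ≤ c := by
      by_contra hn
      push Not at hn
      nlinarith
    have hc1 : c ≤ 1 := by
      by_contra hn
      push Not at hn
      nlinarith
    have ht' : t = 4 * x * c - 3 * x := by linarith
    have e : ∀ v : ℝ, x * t - x ^ 2 * (4 * v - 3) = 4 * x ^ 2 * (c - v) := by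
      intro v
      rw [ht']
      ring
    have hi : ∀ a b : ℝ, IntervalIntegrable
        (fun v : ℝ => max (x * t - x ^ 2 * (4 * v - 3)) 0) volume a b :=
      fun a b => Continuous.intervalIntegrable (by fun_prop) _ _
    rw [← intervalIntegral.integral_add_adjacent_intervals (hi 0 c) (hi c 1)]
    have h1 : ∫ v in (0:ℝ)..c, max (x * t - x ^ 2 * (4 * v - 3)) 0 =
        ∫ v in (0:ℝ)..c, (x * t - x ^ 2 * (4 * v - 3)) := by
      apply intervalIntegral.integral_congr
      intro v hv
      rw [uIcc_of_le hc0] at hv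
      apply max_eq_left
      rw [e]
      exact mul_nonneg (by positivity) (sub_nonneg.2 hv.2)
    have h2 : ∫ v in c..1, max (x * t - x ^ 2 * (4 * v - 3)) 0 =
        ∫ v in c..1, (0:ℝ) := by
      apply intervalIntegral.integral_congr
      intro v hv
      rw [uIcc_of_le hc1] at hv
      apply max_eq_right
      rw [e]
      exact mul_nonpos_of_nonneg_of_nonpos (by positivity) (sub_nonpos.2 hv.1)
    rw [h1, h2, stmt16_aux, intervalIntegral.integral_zero, ht']
    ring
  · intro h
    have h1 : ∫ v in (0:ℝ)..1, max (x * t - x ^ 2 * (4 * v - 3)) 0 =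
        ∫ v in (0:ℝ)..1, (x * t - x ^ 2 * (4 * v - 3)) := by
      apply intervalIntegral.integral_congr
      intro v hv
      rw [uIcc_of_le zero_le_one] at hv
      apply max_eq_left
      have := mul_nonneg hx.le (sub_nonneg.2 h)
      have := mul_nonneg (sq_nonneg x) (sub_nonneg.2 hv.2)
      nlinarith
    rw [h1, stmt16_aux]
    ring
end

section
/- Let β ∈ ℝ, let μ be the uniform probability measure on [0,2] × [0,1], and define Y(x, v) = x β + x²(4v − 3). Then for every t ∈ [0, 2], ∫ ( Y(x,v) − x(β + t) )₊ dμ(x,v) = (2 − t)³ / 48, where z₊ = max(z, 0). -/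
open MeasureTheory Set

lemma inner_aux (t x : ℝ) (ht : 0 ≤ t) (hx : 0 ≤ x) :
    ∫ v in (0:ℝ)..1, max (x ^ 2 * (4 * v - 3) - x * t) 0 = (max (x - t) 0) ^ 2 / 8 := by
  have zero : ∀ b : ℝ, 0 ≤ b → (∀ v ≤ b, x ^ 2 * (4 * v - 3) - x * t ≤ 0) →
      ∫ v in (0:ℝ)..b, max (x ^ 2 * (4 * v - 3) - x * t) 0 = 0 := by
    intro b hb h
    rw [intervalIntegral.integral_congr (g := fun _ => (0:ℝ))]
    · simp
    · intro v hv
      rw [uIcc_of_le hb] at hv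
      exact max_eq_right (h v hv.2)
  rcases lt_or_ge t x with h | h
  · have hx0 : 0 < x := lt_of_le_of_lt ht h
    have hc : Continuous fun v : ℝ => max (x ^ 2 * (4 * v - 3) - x * t) 0 := by fun_prop
    obtain ⟨w, hw⟩ : ∃ w, w = (3 * x + t) / (4 * x) := ⟨_, rfl⟩
    have hw4 : 4 * x * w = 3 * x + t := by rw [hw]; field_simp
    have hw0 : 0 ≤ w := by rw [hw]; positivity
    have hw1 : w ≤ 1 := by rw [hw, div_le_one (by positivity)]; linarith
    have e : ∀ v, x ^ 2 * (4 * v - 3) - x * t = 4 * x ^ 2 * (v - w) := by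
      intro v; linear_combination (x) * hw4
    rw [← intervalIntegral.integral_add_adjacent_intervals (b := w)
      (hc.intervalIntegrable _ _) (hc.intervalIntegrable _ _), zero w hw0,
      intervalIntegral.integral_congr (g := fun v => 4 * x ^ 2 * (v - w))]
    · rw [intervalIntegral.integral_const_mul, intervalIntegral.integral_sub (by simp) (by simp),
        max_eq_left (by linarith)]
      simp only [integral_id, intervalIntegral.integral_const, smul_eq_mul]
      have : x - t = 4 * x * (1 - w) := by linarith
      rw [this]; ring
    · intro v hv
      rw [uIcc_of_le hw1] at hv
      simp only [e]
      exact max_eq_left (mul_nonneg (by positivity) (by linarith [hv.1]))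
    · intro v hv
      rw [e]
      exact mul_nonpos_of_nonneg_of_nonpos (by positivity) (by linarith)
  · rw [zero 1 zero_le_one, max_eq_right (by linarith)]
    · simp
    · intro v hv
      nlinarith [mul_nonneg hx (sub_nonneg.2 h), mul_nonneg (sq_nonneg x) (sub_nonneg.2 hv)]

lemma outer_aux (t : ℝ) (ht : t ∈ Icc (0:ℝ) 2) :
    ∫ x in (0:ℝ)..2, (max (x - t) 0) ^ 2 / 8 = (2 - t) ^ 3 / 24 := by
  have hc : Continuous fun x : ℝ => (max (x - t) 0) ^ 2 / 8 := by fun_prop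
  rw [← intervalIntegral.integral_add_adjacent_intervals (b := t)
      (hc.intervalIntegrable _ _) (hc.intervalIntegrable _ _),
      intervalIntegral.integral_congr (a := 0) (g := fun _ => (0:ℝ)),
      intervalIntegral.integral_congr (a := t) (g := fun x => (x - t) ^ 2 / 8)]
  · rw [intervalIntegral.integral_div,
      intervalIntegral.integral_comp_sub_right (fun x => x ^ 2) t]
    simp only [integral_pow, intervalIntegral.integral_const]
    norm_num
    ring
  · intro v hv
    rw [uIcc_of_le ht.2] at hv
    simp only
    rw [max_eq_left (by linarith [hv.1])]
  · intro v hv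
    rw [uIcc_of_le ht.1] at hv
    simp only
    rw [max_eq_right (by linarith [hv.2])]
    simp



/-- Closed form of `E[(Y - X b)₊]` with `b = β + t` in the paper's Appendix C
counterexample: with `(X, U)` uniform on `[0,2] × [0,1]` and
`Y = Xβ + X²(4U - 3)`, for every `t ∈ [0,2]`,
`E[(Y - X(β + t))₊] = (2 - t)³ / 48`. -/
theorem stmt17
    (β : ℝ) (μ : Measure (ℝ × ℝ))
    (hμ : μ = (2 : ENNReal)⁻¹ • (volume.restrict (Icc (0:ℝ) 2 ×ˢ Icc (0:ℝ) 1)))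
    (Y : ℝ × ℝ → ℝ) (hY : ∀ z : ℝ × ℝ, Y z = z.1 * β + z.1 ^ 2 * (4 * z.2 - 3))
    (t : ℝ) (ht : t ∈ Icc (0:ℝ) 2) :
    ∫ z : ℝ × ℝ, max (Y z - z.1 * (β + t)) 0 ∂μ = (2 - t) ^ 3 / 48 := by
  subst hμ
  have e : ∀ z : ℝ × ℝ, max (Y z - z.1 * (β + t)) 0
      = max (z.1 ^ 2 * (4 * z.2 - 3) - z.1 * t) 0 := by
    intro z; rw [hY]; congr 1; ring
  simp only [e]
  rw [integral_smul_measure, Measure.volume_eq_prod, setIntegral_prod]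
  · have : ∫ x in Icc (0:ℝ) 2, ∫ v in Icc (0:ℝ) 1, max (x ^ 2 * (4 * v - 3) - x * t) 0
        = ∫ x in Icc (0:ℝ) 2, (max (x - t) 0) ^ 2 / 8 := by
      refine setIntegral_congr_fun measurableSet_Icc ?_
      intro x hx
      simp only
      rw [integral_Icc_eq_integral_Ioc, ← intervalIntegral.integral_of_le zero_le_one]
      exact inner_aux t x ht.1 hx.1
    rw [this, integral_Icc_eq_integral_Ioc, ← intervalIntegral.integral_of_le zero_le_two,
      outer_aux t ht]
    simp
    ring
  · refine ContinuousOn.integrableOn_compact (isCompact_Icc.prod isCompact_Icc) ?_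
    fun_prop
end

section
/- Let β ∈ ℝ, let μ be the uniform probability measure on [0,2] × [0,1], and define Y(x, v) = x β + x²(4v − 3). For u ∈ (0,1) define L_u(b) = ∫ [ u ( Y(x,v) − x b )₊ + (1 − u) ( x b − Y(x,v) )₊ ] dμ(x,v), where z₊ = max(z, 0). Then for every u ∈ (0,1) the function b ↦ L_u(b) attains a unique global minimum over ℝ at b = β̄(u), where β̄(u) = β − 6 + 4√(3u) if u ≤ 3/4 and β̄(u) = β + 2 − 4√(1 − u) if u ≥ 3/4. -/
open MeasureTheory Set

noncomputable def gA (c : ℝ) : ℝ × ℝ → ℝ :=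
  indicator {z : ℝ × ℝ | z.1 * (4 * z.2 - 3) ≤ c} (fun z => z.1)

lemma gA_inner (c x : ℝ) (hx : 0 ≤ x) :
    ∫ v in Icc (0:ℝ) 1, gA c (x, v) = max 0 (min x ((3 * x + c) / 4)) := by
  rcases hx.eq_or_lt with h | h
  · subst h
    have : ∀ v, gA c (0, v) = 0 := by
      intro v; simp [gA, indicator]
    simp only [this]
    simp
  · have h1 : ∀ v, gA c (x, v) = indicator (Iic ((3 + c / x) / 4)) (fun _ => x) v := by
      intro v
      have : x * (4 * v - 3) ≤ c ↔ v ≤ (3 + c / x) / 4 := by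
        rw [← le_div_iff₀' h]
        constructor <;> intro h <;> linarith
      simp [gA, indicator, this]
    simp only [h1]
    rw [setIntegral_indicator measurableSet_Iic]
    have h2 : Icc (0:ℝ) 1 ∩ Iic ((3 + c / x) / 4) = Icc 0 (min 1 ((3 + c / x) / 4)) := by
      ext v; simp [and_assoc]
    rw [h2, setIntegral_const, Real.volume_real_Icc, smul_eq_mul, sub_zero, max_mul_of_nonneg _ _ hx,
      min_mul_of_nonneg _ _ hx, max_comm]
    have : (3 + c / x) / 4 * x = (3 * x + c) / 4 := by field_simp
    rw [this]; simp

lemma K_compact : IsCompact (Icc (0:ℝ) 2 ×ˢ Icc (0:ℝ) 1) := isCompact_Icc.prod isCompact_Icc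

lemma gA_int (c : ℝ) : IntegrableOn (gA c) (Icc (0:ℝ) 2 ×ˢ Icc (0:ℝ) 1) := by
  apply Integrable.indicator
  · exact (continuous_fst.continuousOn).integrableOn_compact K_compact
  · exact measurableSet_le (by fun_prop) (by fun_prop)

lemma lin_int (a b c : ℝ) : ∫ x in a..b, (3 * x + c) / 4
    = (3 * (b ^ 2 - a ^ 2) / 2 + c * (b - a)) / 4 := by
  rw [intervalIntegral.integral_div, intervalIntegral.integral_add
    (by apply Continuous.intervalIntegrable; fun_prop) (by simp),
    intervalIntegral.integral_const_mul, integral_id, intervalIntegral.integral_const]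
  simp only [smul_eq_mul]; ring

lemma gA_val1 (c : ℝ) (h0 : -6 < c) (h1 : c ≤ 0) :
    ∫ x in (0:ℝ)..2, max 0 (min x ((3 * x + c) / 4)) = (c + 6) ^ 2 / 24 := by
  have hi : ∀ a b, IntervalIntegrable (fun x : ℝ => max 0 (min x ((3 * x + c) / 4))) volume a b :=
    fun a b => by apply Continuous.intervalIntegrable; fun_prop
  rw [← intervalIntegral.integral_add_adjacent_intervals (hi 0 (-c/3)) (hi _ 2)]
  have e1 : ∫ x in (0:ℝ)..(-c/3), max 0 (min x ((3 * x + c) / 4)) = ∫ x in (0:ℝ)..(-c/3), (0:ℝ) := by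
    apply intervalIntegral.integral_congr
    intro x hx
    rw [uIcc_of_le (by linarith)] at hx
    exact max_eq_left ((min_le_right _ _).trans (by linarith [hx.2]))
  have e2 : ∫ x in (-c/3)..2, max 0 (min x ((3 * x + c) / 4))
      = ∫ x in (-c/3)..2, (3 * x + c) / 4 := by
    apply intervalIntegral.integral_congr
    intro x hx
    rw [uIcc_of_le (by linarith)] at hx
    have := hx.1
    show max 0 (min x ((3 * x + c) / 4)) = _
    rw [min_eq_right (by linarith), max_eq_right (by linarith)]
  rw [e1, e2, lin_int, intervalIntegral.integral_zero]
  ring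

lemma gA_val2 (c : ℝ) (h0 : 0 ≤ c) (h1 : c < 2) :
    ∫ x in (0:ℝ)..2, max 0 (min x ((3 * x + c) / 4)) = 2 - (2 - c) ^ 2 / 8 := by
  have hi : ∀ a b, IntervalIntegrable (fun x : ℝ => max 0 (min x ((3 * x + c) / 4))) volume a b :=
    fun a b => by apply Continuous.intervalIntegrable; fun_prop
  rw [← intervalIntegral.integral_add_adjacent_intervals (hi 0 c) (hi _ 2)]
  have e1 : ∫ x in (0:ℝ)..c, max 0 (min x ((3 * x + c) / 4)) = ∫ x in (0:ℝ)..c, x := by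
    apply intervalIntegral.integral_congr
    intro x hx
    rw [uIcc_of_le (by linarith)] at hx
    show max 0 (min x ((3 * x + c) / 4)) = _
    rw [min_eq_left (by linarith [hx.2]), max_eq_right hx.1]
  have e2 : ∫ x in c..2, max 0 (min x ((3 * x + c) / 4))
      = ∫ x in c..2, (3 * x + c) / 4 := by
    apply intervalIntegral.integral_congr
    intro x hx
    rw [uIcc_of_le (by linarith)] at hx
    have := hx.1
    show max 0 (min x ((3 * x + c) / 4)) = _
    rw [min_eq_right (by linarith), max_eq_right (by linarith)]
  rw [e1, e2, lin_int, integral_id]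
  ring

lemma gA_fub (c : ℝ) : ∫ z in Icc (0:ℝ) 2 ×ˢ Icc (0:ℝ) 1, gA c z
    = ∫ x in (0:ℝ)..2, max 0 (min x ((3 * x + c) / 4)) := by
  have := gA_int c
  rw [Measure.volume_eq_prod] at this ⊢
  rw [setIntegral_prod _ this, intervalIntegral.integral_of_le (by norm_num),
    ← integral_Icc_eq_integral_Ioc]
  apply setIntegral_congr_fun measurableSet_Icc
  intro x hx
  exact gA_inner c x hx.1

lemma fst_val : ∫ z in Icc (0:ℝ) 2 ×ˢ Icc (0:ℝ) 1, z.1 = 2 := by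
  have : IntegrableOn (fun z : ℝ × ℝ => z.1) (Icc (0:ℝ) 2 ×ˢ Icc (0:ℝ) 1) :=
    (continuous_fst.continuousOn).integrableOn_compact K_compact
  rw [Measure.volume_eq_prod] at this ⊢
  rw [setIntegral_prod _ this]
  simp only [setIntegral_const, Real.volume_real_Icc]
  rw [integral_Icc_eq_integral_Ioc, ← intervalIntegral.integral_of_le (by norm_num)]
  norm_num

/-- pointwise subgradient inequality -/
lemma pw (u x w c c0 : ℝ) (hx : 0 ≤ x) (g : ℝ) (hg : g = if w ≤ c0 then x else 0) :
    0 ≤ (u * max (x * (w - c)) 0 + (1 - u) * max (x * (c - w)) 0)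
      - (u * max (x * (w - c0)) 0 + (1 - u) * max (x * (c0 - w)) 0)
      - (c - c0) * (g - u * x) ∧
    (0 < x → (c0 < w ∧ w < c ∨ c < w ∧ w < c0) →
    0 < (u * max (x * (w - c)) 0 + (1 - u) * max (x * (c - w)) 0)
      - (u * max (x * (w - c0)) 0 + (1 - u) * max (x * (c0 - w)) 0)
      - (c - c0) * (g - u * x)) := by
  have key : ∀ d, u * max (x * (w - d)) 0 + (1 - u) * max (x * (d - w)) 0
      = if w ≤ d then (1 - u) * (x * (d - w)) else u * (x * (w - d)) := by
    intro d
    split_ifs with h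
    · rw [max_eq_right (mul_nonpos_of_nonneg_of_nonpos hx (by linarith)),
        max_eq_left (mul_nonneg hx (by linarith))]; ring
    · push Not at h
      rw [max_eq_left (mul_nonneg hx (by linarith)),
        max_eq_right (mul_nonpos_of_nonneg_of_nonpos hx (by linarith))]; ring
  rw [key, key, hg]
  split_ifs with h1 h2 h2
  · refine ⟨by ring_nf; rfl, fun _ h => ?_⟩
    rcases h with h | h <;> linarith [h.1, h.2]
  · push Not at h2
    refine ⟨by nlinarith [mul_nonneg hx (sub_nonneg.2 h1)], fun hp h => ?_⟩
    rcases h with h | h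
    · nlinarith [mul_pos hp (sub_pos.2 h.2)]
    · linarith [h.1, h.2]
  · push Not at h1
    refine ⟨by nlinarith [mul_nonneg hx (sub_nonneg.2 h1.le)], fun hp h => ?_⟩
    rcases h with h | h
    · linarith [h.1, h.2]
    · nlinarith [mul_pos hp (sub_pos.2 h.1)]
  · refine ⟨by ring_nf; rfl, fun _ h => ?_⟩
    push Not at h1 h2
    rcases h with h | h <;> linarith [h.1, h.2]

lemma exists_pt (c c0 : ℝ) (h0 : -6 < c0) (h2 : c0 < 2) (h : c ≠ c0) :
    ∃ x v : ℝ, 0 < x ∧ x < 2 ∧ 0 < v ∧ v < 1 ∧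
      (c0 < x * (4 * v - 3) ∧ x * (4 * v - 3) < c ∨ c < x * (4 * v - 3) ∧ x * (4 * v - 3) < c0) := by
  obtain ⟨t, ht6, ht2, ht⟩ : ∃ t, -6 < t ∧ t < 2 ∧ (c0 < t ∧ t < c ∨ c < t ∧ t < c0) := by
    rcases lt_or_gt_of_ne h with h | h
    · obtain ⟨t, a, b⟩ := exists_between (max_lt h h0)
      exact ⟨t, (le_max_right _ _).trans_lt a, b.trans h2, Or.inr ⟨(le_max_left _ _).trans_lt a, b⟩⟩
    · obtain ⟨t, a, b⟩ := exists_between (lt_min h h2)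
      exact ⟨t, h0.trans a, b.trans_le (min_le_right _ _), Or.inl ⟨a, b.trans_le (min_le_left _ _)⟩⟩
  obtain ⟨x, hx, hx2⟩ := exists_between (max_lt ht2 (show -t/3 < 2 by linarith))
  have a1 := (le_max_left _ _).trans_lt hx
  have a2 := (le_max_right _ _).trans_lt hx
  have hx0 : 0 < x := by linarith
  have b1 : t / x < 1 := by rw [div_lt_one hx0]; exact a1
  have b2 : -3 < t / x := by rw [lt_div_iff₀ hx0]; linarith
  refine ⟨x, (3 + t / x) / 4, hx0, hx2, by linarith, by linarith, ?_⟩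
  have : x * (4 * ((3 + t / x) / 4) - 3) = t := by field_simp; ring
  rw [this]; exact ht

/-- Probability limit of the linear `u`-quantile regression slope in the paper's
Appendix C counterexample: with `(X, U)` uniform on `[0,2] × [0,1]` and
`Y = Xβ + X²(4U - 3)`, the population check loss
`L_u(b) = E[u (Y - Xb)₊ + (1 - u)(Xb - Y)₊]` attains a unique global minimum over
`b ∈ ℝ` at `β̄(u)`, where `β̄(u) = β - 6 + 4√(3u)` for `u ≤ 3/4` and
`β̄(u) = β + 2 - 4√(1 - u)` for `u ≥ 3/4`. -/
theorem stmt18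
    (β : ℝ) (μ : Measure (ℝ × ℝ))
    (hμ : μ = (2 : ENNReal)⁻¹ • (volume.restrict (Icc (0:ℝ) 2 ×ˢ Icc (0:ℝ) 1)))
    (Y : ℝ × ℝ → ℝ) (hY : ∀ z : ℝ × ℝ, Y z = z.1 * β + z.1 ^ 2 * (4 * z.2 - 3))
    (L : ℝ → ℝ → ℝ)
    (hL : ∀ u b, L u b =
      ∫ z : ℝ × ℝ, (u * max (Y z - z.1 * b) 0 + (1 - u) * max (z.1 * b - Y z) 0) ∂μ)
    (βbar : ℝ → ℝ)
    (hβbar : ∀ u ∈ Ioo (0:ℝ) 1,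
      (u ≤ 3/4 → βbar u = β - 6 + 4 * Real.sqrt (3 * u)) ∧
      (3/4 ≤ u → βbar u = β + 2 - 4 * Real.sqrt (1 - u))) :
    ∀ u ∈ Ioo (0:ℝ) 1, ∀ b : ℝ, b ≠ βbar u → L u (βbar u) < L u b := by
  subst hμ
  intro u hu b hb
  obtain ⟨c0, hc0⟩ : ∃ c0, c0 = βbar u - β := ⟨_, rfl⟩
  have hb0 : βbar u = β + c0 := by linarith
  have main : -6 < c0 ∧ c0 < 2 ∧ ∫ z in Icc (0:ℝ) 2 ×ˢ Icc (0:ℝ) 1, gA c0 z = 2 * u := by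
    obtain ⟨hu0, hu1⟩ := hu
    rw [gA_fub]
    rcases le_total u (3/4) with h | h
    · have e := (hβbar u ⟨hu0, hu1⟩).1 h
      have s := Real.sq_sqrt (show 0 ≤ 3 * u by linarith)
      have p := Real.sqrt_pos.2 (show 0 < 3 * u by linarith)
      have q : Real.sqrt (3 * u) ≤ 3/2 := Real.sqrt_le_iff.2 ⟨by norm_num, by linarith⟩
      have e' : c0 = -6 + 4 * Real.sqrt (3 * u) := by linarith
      refine ⟨by linarith, by linarith, ?_⟩
      rw [gA_val1 c0 (by linarith) (by linarith), e']
      linear_combination (2/3) * s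
    · have e := (hβbar u ⟨hu0, hu1⟩).2 h
      have s := Real.sq_sqrt (show 0 ≤ 1 - u by linarith)
      have p := Real.sqrt_pos.2 (show 0 < 1 - u by linarith)
      have q : Real.sqrt (1 - u) ≤ 1/2 := Real.sqrt_le_iff.2 ⟨by norm_num, by linarith⟩
      have e' : c0 = 2 - 4 * Real.sqrt (1 - u) := by linarith
      refine ⟨by linarith, by linarith, ?_⟩
      rw [gA_val2 c0 (by linarith) (by linarith), e']
      linear_combination (-2) * s
  obtain ⟨l6, l2, hg⟩ := main
  obtain ⟨c, hc⟩ : ∃ c, b = β + c := ⟨b - β, by ring⟩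
  have hne : c ≠ c0 := by
    rintro rfl; exact hb (by linarith)
  rw [hb0, hc]
  let F : ℝ → ℝ × ℝ → ℝ := fun d z =>
    u * max (z.1 * (z.1 * (4 * z.2 - 3) - d)) 0 + (1 - u) * max (z.1 * (d - z.1 * (4 * z.2 - 3))) 0
  have hLF : ∀ d, L u (β + d) = 2⁻¹ * ∫ z in Icc (0:ℝ) 2 ×ˢ Icc (0:ℝ) 1, F d z := by
    intro d
    rw [hL, integral_smul_measure]
    simp only [ENNReal.toReal_inv, ENNReal.toReal_ofNat, smul_eq_mul]
    congr 2
    funext z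
    simp only [F, hY]
    ring_nf
  rw [hLF, hLF]
  have hFi : ∀ d, IntegrableOn (F d) (Icc (0:ℝ) 2 ×ˢ Icc (0:ℝ) 1) := by
    intro d
    apply ContinuousOn.integrableOn_compact K_compact
    apply Continuous.continuousOn
    fun_prop
  have hXi : IntegrableOn (fun z : ℝ × ℝ => z.1) (Icc (0:ℝ) 2 ×ˢ Icc (0:ℝ) 1) :=
    (continuous_fst.continuousOn).integrableOn_compact K_compact
  have hGi := gA_int c0
  have hKm : MeasurableSet (Icc (0:ℝ) 2 ×ˢ Icc (0:ℝ) 1) := measurableSet_Icc.prod measurableSet_Icc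
  have hlin : IntegrableOn (fun z : ℝ × ℝ => (c - c0) * (gA c0 z - u * z.1))
      (Icc (0:ℝ) 2 ×ˢ Icc (0:ℝ) 1) := (hGi.sub (hXi.const_mul u)).const_mul _
  have hpw : ∀ z : ℝ × ℝ, 0 ≤ z.1 → _ := fun z hz =>
    pw u z.1 (z.1 * (4 * z.2 - 3)) c c0 hz (gA c0 z) (by simp [gA, indicator])
  have hpos : 0 < ∫ z in Icc (0:ℝ) 2 ×ˢ Icc (0:ℝ) 1,
      (F c z - F c0 z - (c - c0) * (gA c0 z - u * z.1)) := by
    rw [setIntegral_pos_iff_support_of_nonneg_ae]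
    · obtain ⟨x, v, hx0, hx2, hv0, hv1, hw⟩ := exists_pt c c0 l6 l2 hne
      let O : Set (ℝ × ℝ) := {z | 0 < z.1 ∧ z.1 < 2 ∧ 0 < z.2 ∧ z.2 < 1 ∧
        (c0 < z.1 * (4 * z.2 - 3) ∧ z.1 * (4 * z.2 - 3) < c ∨
          c < z.1 * (4 * z.2 - 3) ∧ z.1 * (4 * z.2 - 3) < c0)}
      have hO : IsOpen O := by
        simp only [O, setOf_and, setOf_or]
        repeat' first
          | apply IsOpen.inter
          | apply IsOpen.union
          | apply isOpen_lt
        all_goals fun_prop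
      refine (hO.measure_pos volume ⟨(x, v), hx0, hx2, hv0, hv1, hw⟩).trans_le (measure_mono ?_)
      rintro z ⟨h1, h2, h3, h4, h5⟩
      exact ⟨((hpw z h1.le).2 h1 h5).ne', ⟨h1.le, h2.le⟩, ⟨h3.le, h4.le⟩⟩
    · filter_upwards [ae_restrict_mem hKm] with z hz
      exact (hpw z hz.1.1).1
    · exact ((hFi c).sub (hFi c0)).sub hlin
  have hsplit : ∫ z in Icc (0:ℝ) 2 ×ˢ Icc (0:ℝ) 1,
      (F c z - F c0 z - (c - c0) * (gA c0 z - u * z.1))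
      = (∫ z in Icc (0:ℝ) 2 ×ˢ Icc (0:ℝ) 1, F c z) - (∫ z in Icc (0:ℝ) 2 ×ˢ Icc (0:ℝ) 1, F c0 z)
        - (c - c0) * ((∫ z in Icc (0:ℝ) 2 ×ˢ Icc (0:ℝ) 1, gA c0 z)
          - u * ∫ z in Icc (0:ℝ) 2 ×ˢ Icc (0:ℝ) 1, z.1) := by
    have hd : IntegrableOn (fun z => F c z - F c0 z) (Icc (0:ℝ) 2 ×ˢ Icc (0:ℝ) 1) :=
      (hFi c).sub (hFi c0)
    rw [integral_sub hd hlin, integral_sub (hFi c) (hFi c0),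
      integral_const_mul, integral_sub hGi (hXi.const_mul u), integral_const_mul]
  rw [hsplit, hg, fst_val] at hpos
  have : (c - c0) * (2 * u - u * 2) = 0 := by ring
  linarith
end

section
/- Let β ∈ ℝ and define β̄ : (0,1) → ℝ by β̄(u) = β − 6 + 4√(3u) for u ≤ 3/4 and β̄(u) = β + 2 − 4√(1 − u) for u ≥ 3/4. Then 2 ∫_{1/2}^1 β̄(u) du = β + 10/3 − 8/√6; in particular, 2 ∫_{1/2}^1 β̄(u) du ≠ β. -/
open MeasureTheory Set

/-- Inconsistency of the parametric estimator in the paper's Appendix C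
counterexample: with `β̄(u) = β - 6 + 4√(3u)` for `u ≤ 3/4` and
`β̄(u) = β + 2 - 4√(1 - u)` for `u ≥ 3/4`, one has
`2 ∫_{1/2}^1 β̄(u) du = β + 10/3 - 8/√6 ≠ β`. -/
theorem stmt19
    (β : ℝ) (βbar : ℝ → ℝ)
    (hβbar : ∀ u ∈ Ioo (0:ℝ) 1,
      (u ≤ 3/4 → βbar u = β - 6 + 4 * Real.sqrt (3 * u)) ∧
      (3/4 ≤ u → βbar u = β + 2 - 4 * Real.sqrt (1 - u))) :
    2 * ∫ u in (1/2 : ℝ)..1, βbar u = β + 10/3 - 8 / Real.sqrt 6 ∧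
    2 * ∫ u in (1/2 : ℝ)..1, βbar u ≠ β := by
  have key : ∀ x : ℝ, 0 < x → HasDerivAt (fun y : ℝ => y * Real.sqrt y) (3 / 2 * Real.sqrt x) x := by
    intro x hx
    have h := (hasDerivAt_id x).mul (Real.hasDerivAt_sqrt hx.ne')
    refine h.congr_deriv ?_
    have h0 : 0 < Real.sqrt x := Real.sqrt_pos.mpr hx
    have h1 := Real.mul_self_sqrt hx.le
    simp only [id]
    field_simp
    nlinarith
  have c1 : Continuous (fun u : ℝ => β - 6 + 4 * Real.sqrt (3 * u)) := by fun_prop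
  have c2 : Continuous (fun u : ℝ => β + 2 - 4 * Real.sqrt (1 - u)) := by fun_prop
  have I1 : ∫ u in (1/2 : ℝ)..(3/4), (β - 6 + 4 * Real.sqrt (3 * u)) =
      ((β - 6) * (3/4) + 8/9 * ((3 * (3/4)) * Real.sqrt (3 * (3/4)))) -
      ((β - 6) * (1/2) + 8/9 * ((3 * (1/2)) * Real.sqrt (3 * (1/2)))) := by
    refine intervalIntegral.integral_eq_sub_of_hasDerivAt_of_le
      (f := fun u : ℝ => (β - 6) * u + 8/9 * ((3 * u) * Real.sqrt (3 * u)))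
      (by norm_num) (by fun_prop) ?_ (c1.intervalIntegrable _ _)
    intro x hx
    have hx0 : 0 < 3 * x := by linarith [hx.1]
    have h3 : HasDerivAt (fun u : ℝ => 3 * u) 3 x := by
      simpa using (hasDerivAt_id x).const_mul 3
    have h := (key (3 * x) hx0).comp x h3
    have h4 := ((hasDerivAt_id x).const_mul (β - 6)).add (h.const_mul (8/9))
    refine h4.congr_deriv ?_
    ring
  have I2 : ∫ u in (3/4 : ℝ)..1, (β + 2 - 4 * Real.sqrt (1 - u)) =
      ((β + 2) * 1 + 8/3 * ((1 - 1) * Real.sqrt (1 - 1))) -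
      ((β + 2) * (3/4) + 8/3 * ((1 - 3/4) * Real.sqrt (1 - 3/4))) := by
    refine intervalIntegral.integral_eq_sub_of_hasDerivAt_of_le
      (f := fun u : ℝ => (β + 2) * u + 8/3 * ((1 - u) * Real.sqrt (1 - u)))
      (by norm_num) (by fun_prop) ?_ (c2.intervalIntegrable _ _)
    intro x hx
    have hx0 : 0 < 1 - x := by linarith [hx.2]
    have h3 : HasDerivAt (fun u : ℝ => 1 - u) (-1) x := by
      simpa using (hasDerivAt_id x).const_sub 1
    have h := (key (1 - x) hx0).comp x h3
    have h4 := ((hasDerivAt_id x).const_mul (β + 2)).add (h.const_mul (8/3))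
    refine h4.congr_deriv ?_
    ring
  have e1 : EqOn (fun u : ℝ => β - 6 + 4 * Real.sqrt (3 * u)) βbar (Set.uIoo (1/2 : ℝ) (3/4)) := by
    intro u hu
    rw [Set.uIoo_of_le (by norm_num)] at hu
    exact ((hβbar u ⟨by linarith [hu.1], by linarith [hu.2]⟩).1 hu.2.le).symm
  have e2 : EqOn (fun u : ℝ => β + 2 - 4 * Real.sqrt (1 - u)) βbar (Set.uIoo (3/4 : ℝ) 1) := by
    intro u hu
    rw [Set.uIoo_of_le (by norm_num)] at hu
    exact ((hβbar u ⟨by linarith [hu.1], by linarith [hu.2]⟩).2 hu.1.le).symm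
  have i1 : IntervalIntegrable βbar volume (1/2) (3/4) :=
    (c1.intervalIntegrable _ _).congr_uIoo e1
  have i2 : IntervalIntegrable βbar volume (3/4) 1 :=
    (c2.intervalIntegrable _ _).congr_uIoo e2
  have s1 : Real.sqrt (3 * (3/4)) = 3/2 := by
    rw [show (3 * (3/4) : ℝ) = (3/2)^2 by norm_num]; exact Real.sqrt_sq (by norm_num)
  have s2 : Real.sqrt (1 - 3/4) = 1/2 := by
    rw [show (1 - 3/4 : ℝ) = (1/2)^2 by norm_num]; exact Real.sqrt_sq (by norm_num)
  have s3 : Real.sqrt (3 * (1/2)) = Real.sqrt 6 / 2 := by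
    rw [show (3 * (1/2) : ℝ) = 6 / 2^2 by norm_num, Real.sqrt_div (by norm_num),
      Real.sqrt_sq (by norm_num)]
  have s4 : 8 / Real.sqrt 6 = 4/3 * Real.sqrt 6 := by
    have h0 : 0 < Real.sqrt 6 := Real.sqrt_pos.mpr (by norm_num)
    have h1 := Real.mul_self_sqrt (show (0:ℝ) ≤ 6 by norm_num)
    rw [div_eq_iff h0.ne']
    linarith
  have main : 2 * ∫ u in (1/2 : ℝ)..1, βbar u = β + 10/3 - 8 / Real.sqrt 6 := by
    rw [← intervalIntegral.integral_add_adjacent_intervals i1 i2,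
      ← intervalIntegral.integral_congr_uIoo e1, ← intervalIntegral.integral_congr_uIoo e2,
      I1, I2, s1, s2, s3, s4]
    ring
  refine ⟨main, ?_⟩
  rw [main, s4]
  intro h
  have h1 := Real.mul_self_sqrt (show (0:ℝ) ≤ 6 by norm_num)
  have h2 : Real.sqrt 6 = 5/2 := by linarith
  rw [h2] at h1
  norm_num at h1
end
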